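/- Let X be a transitive countable Markov shift and φ: X → ℝ a measurable function with sup φ < ∞ and sup_{n≥1} D_n(φ) < ∞. Then for any σ-invariant Borel probability measure μ on X with finite entropy there exists a sequence {μ_k} of σ-invariant ergodic Borel probability measures with ∫φ dμ_k > -∞ such that μ_k → μ in the weak*-topology, h(μ_k) → h(μ), and ∫φ dμ_k → ∫φ dμ. -/

import Mathlib

open MeasureTheory Filter Topology Set
open scoped ENNReal NNReal

namespace CMS

/-! ### Generic dynamical notions -/

variable {X : Type*}

/-- Birkhoff sum `S_n φ`. -/
noncomputable def birkhoff (T : X → X) (φ : X → ℝ) (n : ℕ) (x : X) : ℝ :=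
  ∑ i ∈ Finset.range n, φ (T^[i] x)

/-- A measure is invariant under `T`. -/
def Invariant [MeasurableSpace X] (T : X → X) (μ : Measure X) : Prop :=
  Measure.map T μ = μ

/-- `∫ φ dμ > -∞`, i.e. the negative part of `φ` is integrable. -/
def IntegralGtBot [MeasurableSpace X] (φ : X → ℝ) (μ : Measure X) : Prop :=
  (∫⁻ x, ENNReal.ofReal (-φ x) ∂μ) ≠ ⊤

/-- The integral of `φ`, with values in `EReal` (defined whenever one of the parts is finite). -/
noncomputable def eintegral [MeasurableSpace X] (φ : X → ℝ) (μ : Measure X) : EReal :=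
  ((∫⁻ x, ENNReal.ofReal (φ x) ∂μ : ℝ≥0∞) : EReal) -
    ((∫⁻ x, ENNReal.ofReal (-φ x) ∂μ : ℝ≥0∞) : EReal)

/-- Entropy of the countable partition induced by a map `g` with countable range. -/
noncomputable def partitionEntropy [MeasurableSpace X] {α : Type*} (μ : Measure X) (g : X → α) :
    ℝ≥0∞ :=
  ∑' a : α, ENNReal.ofReal (-((μ (g ⁻¹' {a})).toReal * Real.log ((μ (g ⁻¹' {a})).toReal)))

/-- Kolmogorov–Sinaĭ entropy of `T` with respect to `μ`: the supremum over finite measurable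
partitions (coded by maps `X → ℕ` with finite range) of the asymptotic entropy of iterated
joins of the partition. -/
noncomputable def entropy [MeasurableSpace X] (T : X → X) (μ : Measure X) : ℝ≥0∞ :=
  ⨆ (p : X → ℕ) (_ : Measurable p ∧ (Set.range p).Finite),
    atTop.liminf fun n : ℕ =>
      ENNReal.ofReal ((n : ℝ)⁻¹) * partitionEntropy μ (fun x => fun i : Fin n => p (T^[i] x))

/-- The empirical measure `δ_x^n = (1/n) ∑_{i<n} δ_{T^i x}` (with junk convention `n = 0 ↦ n = 1`,
irrelevant since only `n ≥ 1` is ever used). -/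
noncomputable def empirical [MeasurableSpace X] (T : X → X) (x : X) (n : ℕ) :
    ProbabilityMeasure X :=
  ⟨((max n 1 : ℕ) : ℝ≥0∞)⁻¹ • ∑ i ∈ Finset.range (max n 1), Measure.dirac (T^[i] x), by
    refine ⟨?_⟩
    have h1 : (∑ i ∈ Finset.range (max n 1), Measure.dirac (T^[i] x)) Set.univ
        = ((max n 1 : ℕ) : ℝ≥0∞) := by
      rw [Measure.finset_sum_apply]
      simp
    rw [Measure.smul_apply, h1, smul_eq_mul, ENNReal.inv_mul_cancel] <;> simp⟩

noncomputable instance [MeasurableSpace X] [TopologicalSpace X] [OpensMeasurableSpace X] :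
    MeasurableSpace (ProbabilityMeasure X) := borel _

/-- Sets of periodic points. -/
def perSet (T : X → X) (n : ℕ) : Set X := {x | T^[n] x = x}

/-- Sets of iterated preimages of a point. -/
def preimSet (T : X → X) (n : ℕ) (y : X) : Set X := {x | T^[n] x = y}

/-- The partition function `Z_n(φ, C)` over a subset `C`. -/
noncomputable def Zfn [MeasurableSpace X] (T : X → X) (φ : X → ℝ) (n : ℕ) (C : Set X) : ℝ≥0∞ :=
  ∑' x : C, ENNReal.ofReal (Real.exp (birkhoff T φ n x))

/-- The distribution of the empirical measures under `μ`. -/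
noncomputable def empDistr [MeasurableSpace X] [TopologicalSpace X] [OpensMeasurableSpace X]
    (T : X → X) (μ : Measure X) (n : ℕ) : Measure (ProbabilityMeasure X) :=
  Measure.map (fun x => empirical T x n) μ

/-- The distribution `Z_n(φ,C)⁻¹ ∑_{x ∈ C} e^{S_nφ(x)} δ_{δ_x^n}` on the space of probability
measures, for a countable set `C` (of weighted periodic points or iterated preimages). -/
noncomputable def weightedDistr [MeasurableSpace X] [TopologicalSpace X] [OpensMeasurableSpace X]
    (T : X → X) (φ : X → ℝ) (n : ℕ) (C : Set X) : Measure (ProbabilityMeasure X) :=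
  (Zfn T φ n C)⁻¹ •
    Measure.sum (fun x : C =>
      ENNReal.ofReal (Real.exp (birkhoff T φ n x)) • Measure.dirac (empirical T (x : X) n))

/-! ### Large deviations notions -/

variable {Y : Type*}

/-- The large deviation principle for a sequence of (sub)probability measures with rate
function `J`. -/
def HasLDP [TopologicalSpace Y] [MeasurableSpace Y] (μ : ℕ → Measure Y) (J : Y → EReal) : Prop :=
  (∀ G : Set Y, IsOpen G →
      -(⨅ y ∈ G, J y) ≤
        atTop.liminf fun n : ℕ => (((n : ℝ)⁻¹ : ℝ) : EReal) * ENNReal.log (μ n G)) ∧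
  (∀ K : Set Y, IsClosed K →
      atTop.limsup (fun n : ℕ => (((n : ℝ)⁻¹ : ℝ) : EReal) * ENNReal.log (μ n K)) ≤
        -(⨅ y ∈ K, J y))

/-- Exponential tightness of a sequence of measures. -/
def ExpTight [TopologicalSpace Y] [MeasurableSpace Y] (μ : ℕ → Measure Y) : Prop :=
  ∀ L : ℝ, 0 < L → ∃ K : Set Y, IsCompact K ∧
    atTop.limsup (fun n : ℕ => (((n : ℝ)⁻¹ : ℝ) : EReal) * ENNReal.log (μ n Kᶜ)) ≤ ((-L : ℝ) : EReal)

/-- A good rate function: lower semicontinuous with compact sublevel sets. -/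
def GoodRate [TopologicalSpace Y] (J : Y → EReal) : Prop :=
  LowerSemicontinuous J ∧ ∀ α : ℝ, 0 ≤ α → IsCompact {y | J y ≤ (α : EReal)}

/-- The rate function `I(μ) = - inf_{G ∋ μ} sup_G F`. -/
noncomputable def rateOf [TopologicalSpace Y] (F : Y → EReal) (μ : Y) : EReal :=
  -(⨅ (G : Set Y) (_ : IsOpen G ∧ μ ∈ G), ⨆ ν ∈ G, F ν)

/-- The convex combination `t μ + (1-t) ν` of two probability measures. -/
noncomputable def mix [MeasurableSpace X] (t : ℝ) (h0 : 0 ≤ t) (h1 : t ≤ 1)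
    (μ ν : ProbabilityMeasure X) : ProbabilityMeasure X :=
  ⟨ENNReal.ofReal t • (μ : Measure X) + ENNReal.ofReal (1 - t) • (ν : Measure X), by
    refine ⟨?_⟩
    simp only [Measure.add_apply, Measure.smul_apply, smul_eq_mul, measure_univ, mul_one]
    rw [← ENNReal.ofReal_add h0 (by linarith)]
    norm_num⟩

/-- Convexity of a rate function on probability measures. -/
def ConvexRate [MeasurableSpace X] (J : ProbabilityMeasure X → EReal) : Prop :=
  ∀ μ ν : ProbabilityMeasure X, ∀ t : ℝ, ∀ (h0 : 0 ≤ t) (h1 : t ≤ 1),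
    J (mix t h0 h1 μ ν) ≤ ((t : ℝ) : EReal) * J μ + ((1 - t : ℝ) : EReal) * J ν

-- The free energy functional `F`.
open Classical in
noncomputable def freeEnergy [MeasurableSpace X] (T : X → X) (φ : X → ℝ) (P : ℝ)
    (ν : ProbabilityMeasure X) : EReal :=
  if Invariant T (ν : Measure X) ∧ IntegralGtBot φ (ν : Measure X)
  then ((entropy T (ν : Measure X) : ℝ≥0∞) : EReal) + eintegral φ (ν : Measure X) - ((P : ℝ) : EReal)
  else ⊥

/-! ### Countable Markov shifts -/

variable {S : Type*}

/-- The topological Markov shift with alphabet `S` and transition relation `A`. -/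
def Space (A : S → S → Prop) : Type _ := {x : ℕ → S // ∀ i, A (x i) (x (i + 1))}

variable (A : S → S → Prop)

instance [TopologicalSpace S] : TopologicalSpace (Space A) :=
  inferInstanceAs (TopologicalSpace {x : ℕ → S // ∀ i, A (x i) (x (i + 1))})

noncomputable instance [TopologicalSpace S] : MeasurableSpace (Space A) := borel _

instance [TopologicalSpace S] : BorelSpace (Space A) := ⟨rfl⟩

/-- The left shift. -/
def shift : Space A → Space A := fun x => ⟨fun i => x.1 (i + 1), fun i => x.2 (i + 1)⟩

/-- Admissible words. -/
def Admissible (w : List S) : Prop := w ≠ [] ∧ w.Chain' A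

/-- The cylinder set of a word. -/
def cylinder (w : List S) : Set (Space A) := {x | ∀ i : Fin w.length, x.1 i = w.get i}

variable {A}

/-- The initial word of length `n` of a point. -/
def word (x : Space A) (n : ℕ) : List S := List.ofFn (fun i : Fin n => x.1 i)

variable (A)

/-- `μ` is a Gibbs state for the potential `φ` with constants `c₀` and `P`. -/
def IsGibbsWith [TopologicalSpace S] (φ : Space A → ℝ) (μ : Measure (Space A)) (c₀ P : ℝ) :
    Prop :=
  ∀ n : ℕ, 1 ≤ n → ∀ x : Space A,
    c₀⁻¹ * Real.exp (-(P * n) + birkhoff (shift A) φ n x)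
        ≤ (μ (cylinder A (word x n))).toReal ∧
      (μ (cylinder A (word x n))).toReal
        ≤ c₀ * Real.exp (-(P * n) + birkhoff (shift A) φ n x)

/-- `μ` is a Gibbs state for `φ`. -/
def IsGibbs [TopologicalSpace S] (φ : Space A → ℝ) (μ : Measure (Space A)) : Prop :=
  ∃ c₀ P : ℝ, 1 ≤ c₀ ∧ IsGibbsWith A φ μ c₀ P

/-- The transition matrix has no row or column identically zero. -/
def NoZeroRowCol : Prop := (∀ a : S, ∃ b, A a b) ∧ ∀ b : S, ∃ a, A a b

/-- Finite irreducibility. -/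
def FinitelyIrreducible : Prop :=
  ∃ Λ : Finset (List S), ∀ v w : List S, Admissible A v → Admissible A w →
    ∃ l ∈ Λ, Admissible A (v ++ l ++ w)

/-- Finite primitiveness. -/
def FinitelyPrimitive : Prop :=
  ∃ Λ : Finset (List S), (∃ N : ℕ, ∀ l ∈ Λ, l.length = N) ∧
    ∀ v w : List S, Admissible A v → Admissible A w →
      ∃ l ∈ Λ, Admissible A (v ++ l ++ w)

/-- Topological transitivity. -/
def TopTransitive : Prop :=
  ∀ a b : S, ∃ n : ℕ, 1 ≤ n ∧
    (cylinder A [a] ∩ (shift A)^[n] ⁻¹' (cylinder A [b])).Nonempty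

/-- Varadhan's functional `Q(ψ) = sup_μ (∫ψ dμ - I(μ))`. -/
noncomputable def varQ {X : Type*} [MeasurableSpace X] (I : ProbabilityMeasure X → EReal)
    (ψ : X → ℝ) : EReal :=
  ⨆ μ : ProbabilityMeasure X, (((∫ x, ψ x ∂(μ : Measure X)) : ℝ) : EReal) - I μ

/-- `φ` is uniformly continuous for the standard metric of the shift space. -/
def UnifCont (φ : Space A → ℝ) : Prop :=
  ∀ ε : ℝ, 0 < ε → ∃ N : ℕ, ∀ x y : Space A, (∀ i < N, x.1 i = y.1 i) → |φ x - φ y| ≤ ε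

/-- `φ` is bounded. -/
def Bdd (φ : Space A → ℝ) : Prop := ∃ C : ℝ, ∀ x : Space A, |φ x| ≤ C

end CMS

namespace CMS

/-! ### Shannon entropy of maps with values in a finite type -/

section FiniteEntropy

open Real

lemma negMulLog_sum_le {ι : Type*} (s : Finset ι) (p : ι → ℝ) (hp : ∀ i ∈ s, 0 ≤ p i) :
    negMulLog (∑ i ∈ s, p i) ≤ ∑ i ∈ s, negMulLog (p i) := by
  rw [negMulLog, neg_mul, Finset.sum_mul, ← Finset.sum_neg_distrib]
  refine Finset.sum_le_sum fun i hi => ?_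
  rw [negMulLog, neg_mul, neg_le_neg_iff]
  rcases (hp i hi).eq_or_lt with h | h
  · simp [← h]
  · exact mul_le_mul_of_nonneg_left (log_le_log h (Finset.single_le_sum hp hi)) h.le

lemma negMulLog_le_cross {p c : ℝ} (hp : 0 ≤ p) (hc : 0 ≤ c) (h : c = 0 → p = 0) :
    negMulLog p ≤ -(p * log c) + c - p := by
  rcases hp.eq_or_lt with h0 | h0
  · simp [← h0, hc]
  have hc' : 0 < c := lt_of_le_of_ne hc fun h' => h0.ne' (h h'.symm)
  have h1 := log_le_sub_one_of_pos (div_pos hc' h0)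
  rw [log_div hc'.ne' h0.ne'] at h1
  have h2 := mul_le_mul_of_nonneg_left h1 hp
  have h3 : p * (c / p - 1) = c - p := by field_simp
  rw [negMulLog]
  linarith

lemma sum_negMulLog_le {α : Type*} [Fintype α] (B : α → ℝ) (hB : ∀ a, 0 ≤ B a) :
    ∑ a, negMulLog (B a) ≤
      negMulLog (∑ a, B a) + (∑ a, B a) * log (Fintype.card α) := by
  set b := ∑ a, B a with hb
  have hb0 : 0 ≤ b := Finset.sum_nonneg fun a _ => hB a
  rcases hb0.eq_or_lt with h0 | h0
  · have : ∀ a, B a = 0 := by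
      have := (Finset.sum_eq_zero_iff_of_nonneg (fun a _ => hB a)).1 (hb.symm.trans h0.symm)
      simpa using this
    simp [this, ← h0]
  have hne : Nonempty α := by
    by_contra hcon
    rw [not_nonempty_iff] at hcon
    simp [hb] at h0
  have hcard : (0 : ℝ) < Fintype.card α := by exact_mod_cast Fintype.card_pos
  have hc : 0 < b / Fintype.card α := div_pos h0 hcard
  calc ∑ a, negMulLog (B a)
      ≤ ∑ a, (-(B a * log (b / Fintype.card α)) + b / Fintype.card α - B a) :=
        Finset.sum_le_sum fun a _ => negMulLog_le_cross (hB a) hc.le fun h => absurd h hc.ne'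
    _ = _ := by
        rw [Finset.sum_sub_distrib, Finset.sum_add_distrib, Finset.sum_neg_distrib,
          ← Finset.sum_mul, ← hb, log_div h0.ne' hcard.ne', Finset.sum_const, Finset.card_univ,
          nsmul_eq_mul, mul_div_cancel₀ _ hcard.ne', negMulLog]
        ring

/-- Shannon entropy of the partition induced by a map with values in a finite type. -/
noncomputable def finEntropy {Ω α : Type*} [MeasurableSpace Ω] [Fintype α] (μ : Measure Ω)
    (g : Ω → α) : ℝ :=
  ∑ a, negMulLog (μ.real (g ⁻¹' {a}))

/-- The fibres of `g` are measurable. -/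
def FibMeas {Ω α : Type*} [MeasurableSpace Ω] (g : Ω → α) : Prop :=
  ∀ a, MeasurableSet (g ⁻¹' {a})

section FibMeas

variable {Ω Ω' α β : Type*} [MeasurableSpace Ω] [MeasurableSpace Ω']

lemma FibMeas.preimage [Countable α] {g : Ω → α} (hg : FibMeas g) (s : Set α) :
    MeasurableSet (g ⁻¹' s) := by
  rw [← Set.biUnion_preimage_singleton]
  exact MeasurableSet.biUnion s.to_countable fun a _ => hg a

lemma FibMeas.comp [Countable α] {g : Ω → α} (hg : FibMeas g) (f : α → β) :
    FibMeas (f ∘ g) := fun b => by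
  rw [Set.preimage_comp]
  exact hg.preimage _

lemma FibMeas.comp_measurable {g : Ω → α} (hg : FibMeas g)
    {f : Ω' → Ω} (hf : Measurable f) : FibMeas (g ∘ f) := fun b => hf (hg b)

lemma FibMeas.prodMk {g : Ω → α} {h : Ω → β} (hg : FibMeas g) (hh : FibMeas h) :
    FibMeas fun x => (g x, h x) := fun ⟨a, b⟩ => by
  have : (fun x => (g x, h x)) ⁻¹' {(a, b)} = g ⁻¹' {a} ∩ h ⁻¹' {b} := by
    ext; simp [Prod.ext_iff]
  rw [this]
  exact (hg a).inter (hh b)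

lemma FibMeas.pi {ι : Type*} [Finite ι] {g : ι → Ω → α} (hg : ∀ i, FibMeas (g i)) :
    FibMeas fun x i => g i x := fun f => by
  have : (fun x i => g i x) ⁻¹' {f} = ⋂ i, g i ⁻¹' {f i} := by
    ext; simp [funext_iff]
  rw [this]
  have := Fintype.ofFinite ι
  exact MeasurableSet.iInter fun i => hg i (f i)

end FibMeas

variable {Ω α β : Type*} [MeasurableSpace Ω] [Fintype α] [Fintype β]

lemma sum_measureReal_fib (μ : Measure Ω) [IsFiniteMeasure μ] {g : Ω → α} (hg : FibMeas g)
    (s : Set Ω) : ∑ a, μ.real (g ⁻¹' {a} ∩ s) = μ.real s := by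
  simp_rw [← measureReal_restrict_apply (hg _)]
  rw [← measureReal_biUnion_finset]
  · have : ⋃ a ∈ (Finset.univ : Finset α), g ⁻¹' {a} = Set.univ := by ext; simp
    rw [this, measureReal_restrict_apply_univ]
  · intro a _ b _ hab
    exact Disjoint.preimage _ (by simpa using hab)
  · exact fun a _ => hg a

lemma finEntropy_nonneg (μ : Measure Ω) [IsZeroOrProbabilityMeasure μ] (g : Ω → α) :
    0 ≤ finEntropy μ g :=
  Finset.sum_nonneg fun _ _ => negMulLog_nonneg measureReal_nonneg measureReal_le_one

lemma finEntropy_comp_le (μ : Measure Ω) [IsFiniteMeasure μ] {g : Ω → α} (hg : FibMeas g)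
    (f : α → β) : finEntropy μ (f ∘ g) ≤ finEntropy μ g := by
  classical
  have key : ∀ b, μ.real ((f ∘ g) ⁻¹' {b}) = ∑ a with f a = b, μ.real (g ⁻¹' {a}) := fun b => by
    rw [← measureReal_biUnion_finset]
    · congr 1
      ext x; simp
    · intro a _ a' _ haa
      exact Disjoint.preimage _ (by simpa using haa)
    · exact fun a _ => hg a
  calc finEntropy μ (f ∘ g) ≤ ∑ b, ∑ a with f a = b, negMulLog (μ.real (g ⁻¹' {a})) := by
        refine Finset.sum_le_sum fun b _ => ?_
        rw [key]
        exact negMulLog_sum_le _ _ fun _ _ => measureReal_nonneg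
    _ = _ := Finset.sum_fiberwise _ _ _

lemma finEntropy_pair_le (μ : Measure Ω) [IsProbabilityMeasure μ] {g : Ω → α} {h : Ω → β}
    (hg : FibMeas g) (hh : FibMeas h) :
    finEntropy μ (fun x => (g x, h x)) ≤ finEntropy μ g + finEntropy μ h := by
  have hpre : ∀ a b, (fun x => (g x, h x)) ⁻¹' {(a, b)} = g ⁻¹' {a} ∩ h ⁻¹' {b} := fun a b => by
    ext; simp [Prod.ext_iff]
  set p : α → ℝ := fun a => μ.real (g ⁻¹' {a}) with hp
  set q : β → ℝ := fun b => μ.real (h ⁻¹' {b}) with hq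
  set P : α → β → ℝ := fun a b => μ.real (g ⁻¹' {a} ∩ h ⁻¹' {b}) with hP
  have hP0 : ∀ a b, 0 ≤ P a b := fun _ _ => measureReal_nonneg
  have hPp : ∀ a b, P a b ≤ p a := fun _ _ => measureReal_mono Set.inter_subset_left
  have hPq : ∀ a b, P a b ≤ q b := fun _ _ => measureReal_mono Set.inter_subset_right
  have hsp : ∀ a, ∑ b, P a b = p a := fun a => by
    change _ = μ.real (g ⁻¹' {a})
    rw [← sum_measureReal_fib μ hh]
    exact Finset.sum_congr rfl fun b _ => by simp only [hP, Set.inter_comm]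
  have hsq : ∀ b, ∑ a, P a b = q b := fun b => sum_measureReal_fib μ hg _
  have hs1 : ∑ a, p a = 1 := by
    have := sum_measureReal_fib μ hg Set.univ
    simpa using this
  have hs2 : ∑ b, q b = 1 := by
    have := sum_measureReal_fib μ hh Set.univ
    simpa using this
  have hterm : ∀ a b, negMulLog (P a b) ≤
      -(P a b * log (p a)) - P a b * log (q b) + p a * q b - P a b := fun a b => by
    rcases (hP0 a b).eq_or_lt with h0 | h0
    · simp only [← h0, negMulLog_zero, zero_mul, neg_zero, sub_zero, zero_add]
      exact mul_nonneg measureReal_nonneg measureReal_nonneg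
    have hpa := h0.trans_le (hPp a b)
    have hqb := h0.trans_le (hPq a b)
    have := negMulLog_le_cross (hP0 a b) (mul_pos hpa hqb).le fun h => absurd h
      (mul_pos hpa hqb).ne'
    rw [log_mul hpa.ne' hqb.ne'] at this
    linarith
  have hA : ∑ a, ∑ b, P a b * log (p a) = ∑ a, p a * log (p a) :=
    Finset.sum_congr rfl fun a _ => by rw [← Finset.sum_mul, hsp]
  have hB : ∑ a, ∑ b, P a b * log (q b) = ∑ b, q b * log (q b) := by
    rw [Finset.sum_comm]
    exact Finset.sum_congr rfl fun a _ => by rw [← Finset.sum_mul, hsq]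
  have hC : ∑ a, ∑ b, p a * q b = 1 := by
    rw [← Finset.sum_mul_sum, hs1, hs2, one_mul]
  have hD : ∑ a, ∑ b, P a b = 1 := by simp_rw [hsp, hs1]
  have hg' : finEntropy μ g = -∑ a, p a * log (p a) := by
    simp [finEntropy, negMulLog, Finset.sum_neg_distrib, hp]
  have hh' : finEntropy μ h = -∑ b, q b * log (q b) := by
    simp [finEntropy, negMulLog, Finset.sum_neg_distrib, hq]
  calc finEntropy μ (fun x => (g x, h x)) = ∑ a, ∑ b, negMulLog (P a b) := by
        rw [finEntropy, Fintype.sum_prod_type]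
        simp_rw [hpre, hP]
    _ ≤ ∑ a, ∑ b, (-(P a b * log (p a)) - P a b * log (q b) + p a * q b - P a b) :=
        Finset.sum_le_sum fun a _ => Finset.sum_le_sum fun b _ => hterm a b
    _ = _ := by
        simp only [Finset.sum_sub_distrib, Finset.sum_add_distrib, Finset.sum_neg_distrib, hA, hB,
          hC, hD, hg', hh']
        ring

lemma finEntropy_le_log_card (μ : Measure Ω) [IsProbabilityMeasure μ] {g : Ω → α}
    (hg : FibMeas g) : finEntropy μ g ≤ log (Fintype.card α) := by
  have h := sum_negMulLog_le (fun a => μ.real (g ⁻¹' {a})) fun _ => measureReal_nonneg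
  have h1 : ∑ a, μ.real (g ⁻¹' {a}) = 1 := by
    have := sum_measureReal_fib μ hg Set.univ
    simpa using this
  simpa [h1, finEntropy] using h

lemma finEntropy_equiv (μ : Measure Ω) (g : Ω → α) (e : α ≃ β) :
    finEntropy μ (e ∘ g) = finEntropy μ g := by
  rw [finEntropy, finEntropy, ← e.sum_comp]
  refine Finset.sum_congr rfl fun a _ => ?_
  congr 2
  ext x; simp

lemma finEntropy_pi_le (μ : Measure Ω) [IsProbabilityMeasure μ] {n : ℕ} {g : Fin n → Ω → α}
    (hg : ∀ i, FibMeas (g i)) :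
    finEntropy μ (fun x i => g i x) ≤ ∑ i, finEntropy μ (g i) := by
  induction n with
  | zero =>
    have h := finEntropy_le_log_card μ (FibMeas.pi hg)
    simpa using h
  | succ n ih =>
    rw [Fin.sum_univ_succ]
    have h1 := finEntropy_pair_le μ (hg 0) (FibMeas.pi fun i => hg (Fin.succ i))
    have h2 : (fun x i => g i x) =
        (Fin.consEquiv fun _ => α) ∘ fun x => (g 0 x, fun i => g (Fin.succ i) x) := by
      funext x i
      refine Fin.cases ?_ (fun j => ?_) i <;> simp [Fin.consEquiv]
    rw [h2, finEntropy_equiv]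
    exact h1.trans (add_le_add le_rfl (ih fun i => hg i.succ))

lemma finEntropy_map {Ω' : Type*} [MeasurableSpace Ω'] (μ : Measure Ω') {f : Ω' → Ω}
    (hf : Measurable f) {g : Ω → α} (hg : FibMeas g) :
    finEntropy (μ.map f) g = finEntropy μ (g ∘ f) :=
  Finset.sum_congr rfl fun a _ => by
    rw [map_measureReal_apply hf (hg a), Set.preimage_comp]

lemma finEntropy_comp_of_invariant {T : Ω → Ω} {μ : Measure Ω} (hT : Measurable T)
    (h : Invariant T μ) {g : Ω → α} (hg : FibMeas g) (i : ℕ) :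
    finEntropy μ (g ∘ T^[i]) = finEntropy μ g := by
  have : μ.map T^[i] = μ := (MeasurePreserving.iterate ⟨hT, h⟩ i).map_eq
  rw [← finEntropy_map μ (hT.iterate i) hg, this]

section Mixture

variable {ι : Type*} (s : Finset ι) (w : ι → ℝ) (ν : ι → Measure Ω) (μ : Measure Ω) (g : Ω → α)

lemma sum_finEntropy_le_of_mixture (hw : ∀ i ∈ s, 0 ≤ w i) (hw1 : ∑ i ∈ s, w i = 1)
    (hμ : ∀ a, μ.real (g ⁻¹' {a}) = ∑ i ∈ s, w i * (ν i).real (g ⁻¹' {a})) :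
    ∑ i ∈ s, w i * finEntropy (ν i) g ≤ finEntropy μ g := by
  simp_rw [finEntropy, Finset.mul_sum]
  rw [Finset.sum_comm]
  refine Finset.sum_le_sum fun a _ => ?_
  rw [hμ]
  have := concaveOn_negMulLog.le_map_sum (t := s) (w := w)
    (p := fun i => (ν i).real (g ⁻¹' {a})) hw hw1 fun i _ => measureReal_nonneg
  simpa using this

lemma finEntropy_le_of_mixture (hw : ∀ i ∈ s, 0 ≤ w i) [∀ i, IsProbabilityMeasure (ν i)]
    (hg : FibMeas g)
    (hμ : ∀ a, μ.real (g ⁻¹' {a}) = ∑ i ∈ s, w i * (ν i).real (g ⁻¹' {a})) :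
    finEntropy μ g ≤ ∑ i ∈ s, w i * finEntropy (ν i) g + ∑ i ∈ s, negMulLog (w i) := by
  have h1 : ∀ i, ∑ a, (ν i).real (g ⁻¹' {a}) = 1 := fun i => by
    have := sum_measureReal_fib (ν i) hg Set.univ
    simpa using this
  calc finEntropy μ g
      ≤ ∑ a, ∑ i ∈ s, negMulLog (w i * (ν i).real (g ⁻¹' {a})) := by
        refine Finset.sum_le_sum fun a _ => ?_
        rw [hμ]
        exact negMulLog_sum_le _ _ fun i hi => mul_nonneg (hw i hi) measureReal_nonneg
    _ = _ := by
        rw [Finset.sum_comm, ← Finset.sum_add_distrib]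
        refine Finset.sum_congr rfl fun i _ => ?_
        simp_rw [negMulLog_mul]
        rw [Finset.sum_add_distrib, ← Finset.sum_mul, h1, one_mul, finEntropy, Finset.mul_sum,
          add_comm]

end Mixture

lemma measureReal_mul_cond {Ω : Type*} [MeasurableSpace Ω] (μ : Measure Ω) [IsFiniteMeasure μ]
    {G : Set Ω} (hG : MeasurableSet G) (s : Set Ω) :
    μ.real G * (ProbabilityTheory.cond μ G).real s = μ.real (G ∩ s) := by
  rw [measureReal_def, measureReal_def, ← ENNReal.toReal_mul, mul_comm,
    ProbabilityTheory.cond_mul_eq_inter hG, measureReal_def]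

lemma mul_finEntropy_cond_le (μ : Measure Ω) [IsProbabilityMeasure μ] {G : Set Ω}
    (hG : MeasurableSet G) (g : Ω → α) :
    μ.real G * finEntropy (ProbabilityTheory.cond μ G) g ≤ finEntropy μ g := by
  have h := sum_finEntropy_le_of_mixture Finset.univ
    (fun b : Bool => bif b then μ.real G else μ.real Gᶜ)
    (fun b : Bool => bif b then ProbabilityTheory.cond μ G else ProbabilityTheory.cond μ Gᶜ) μ g
    (by simp) (by simp [probReal_add_probReal_compl hG]) (fun a => by
      simp only [Fintype.sum_bool, cond_true, cond_false, measureReal_mul_cond μ hG,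
        measureReal_mul_cond μ hG.compl]
      rw [Set.inter_comm, Set.inter_comm Gᶜ, ← Set.sdiff_eq, measureReal_inter_add_sdiff hG])
  simp only [Fintype.sum_bool, cond_true, cond_false] at h
  have := mul_nonneg (measureReal_nonneg (μ := μ) (s := Gᶜ))
    (finEntropy_nonneg (ProbabilityTheory.cond μ Gᶜ) g)
  linarith

lemma finEntropy_le_cond (μ : Measure Ω) [IsProbabilityMeasure μ] {G : Set Ω}
    (hG : MeasurableSet G) (hG0 : μ G ≠ 0) {g : Ω → α} (hg : FibMeas g) :
    finEntropy μ g ≤ μ.real G * finEntropy (ProbabilityTheory.cond μ G) g +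
      negMulLog (μ.real G) + negMulLog (μ.real Gᶜ) + μ.real Gᶜ * log (Fintype.card α) := by
  have hpos : ∀ a, 0 ≤ μ.real (g ⁻¹' {a} ∩ Gᶜ) := fun _ => measureReal_nonneg
  have h1 := sum_negMulLog_le (fun a => μ.real (g ⁻¹' {a} ∩ Gᶜ)) hpos
  rw [sum_measureReal_fib μ hg] at h1
  have h2 : ∑ a, negMulLog (μ.real (g ⁻¹' {a} ∩ G)) =
      μ.real G * finEntropy (ProbabilityTheory.cond μ G) g + negMulLog (μ.real G) := by
    have h3 : ∀ a, μ.real (g ⁻¹' {a} ∩ G) =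
        μ.real G * (ProbabilityTheory.cond μ G).real (g ⁻¹' {a}) := fun a => by
      rw [measureReal_mul_cond μ hG, Set.inter_comm]
    have := ProbabilityTheory.cond_isProbabilityMeasure hG0
    have h4 := sum_measureReal_fib (ProbabilityTheory.cond μ G) hg Set.univ
    simp only [Set.inter_univ, probReal_univ] at h4
    simp_rw [h3, negMulLog_mul]
    rw [Finset.sum_add_distrib, ← Finset.sum_mul, h4, finEntropy, Finset.mul_sum]
    ring
  have h5 : finEntropy μ g ≤ ∑ a, negMulLog (μ.real (g ⁻¹' {a} ∩ G)) +
      ∑ a, negMulLog (μ.real (g ⁻¹' {a} ∩ Gᶜ)) := by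
    rw [← Finset.sum_add_distrib]
    refine Finset.sum_le_sum fun a _ => ?_
    rw [← measureReal_inter_add_sdiff (s := g ⁻¹' {a}) hG, Set.sdiff_eq]
    have := negMulLog_sum_le Finset.univ
      (fun b : Bool => bif b then μ.real (g ⁻¹' {a} ∩ G) else μ.real (g ⁻¹' {a} ∩ Gᶜ))
      (by simp)
    simpa using this
  linarith

end FiniteEntropy

/-! ### Reduction of the Kolmogorov–Sinaĭ entropy to generating finite partitions -/

section Rate

variable {X α β : Type*} [MeasurableSpace X] [Fintype α] [Fintype β]

/-- The itinerary of length `n` of a point with respect to the partition coded by `p`. -/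
def itin {X α : Type*} (T : X → X) (p : X → α) (n : ℕ) (x : X) : Fin n → α := fun i => p (T^[i] x)

/-- The entropy rate of the partition coded by `p`. -/
noncomputable def entropyRate (T : X → X) (μ : Measure X) (p : X → α) : ℝ≥0∞ :=
  atTop.liminf fun n : ℕ => ENNReal.ofReal ((n : ℝ)⁻¹ * finEntropy μ (itin T p n))

lemma FibMeas.itin {X α : Type*} [MeasurableSpace X] {T : X → X} (hT : Measurable T) {p : X → α}
    (hp : FibMeas p) (n : ℕ) : FibMeas (itin T p n) :=
  FibMeas.pi fun i : Fin n => hp.comp_measurable (hT.iterate i)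

lemma partitionEntropy_comp_injective {X α β : Type*} [MeasurableSpace X] (μ : Measure X)
    (g : X → α) {f : α → β} (hf : f.Injective) :
    partitionEntropy μ (f ∘ g) = partitionEntropy μ g := by
  rw [partitionEntropy, partitionEntropy, ← hf.tsum_eq]
  · congr with a
    have : f ∘ g ⁻¹' {f a} = g ⁻¹' {a} := by ext; simp [hf.eq_iff]
    rw [this]
  · intro b hb
    by_contra hcon
    have : f ∘ g ⁻¹' {b} = ∅ := by
      ext x
      simp only [Set.mem_preimage, Function.comp_apply, Set.mem_singleton_iff,
        Set.mem_empty_iff_false, iff_false]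
      rintro rfl
      exact hcon ⟨_, rfl⟩
    simp [this] at hb

lemma partitionEntropy_eq_ofReal (μ : Measure X) [IsProbabilityMeasure μ] (g : X → α) :
    partitionEntropy μ g = ENNReal.ofReal (finEntropy μ g) := by
  rw [partitionEntropy, tsum_fintype, finEntropy, ENNReal.ofReal_sum_of_nonneg]
  · simp [Real.negMulLog, measureReal_def]
  · exact fun _ _ => Real.negMulLog_nonneg measureReal_nonneg measureReal_le_one

lemma liminf_partitionEntropy_eq (T : X → X) (μ : Measure X) [IsProbabilityMeasure μ] (p : X → α)
    {f : α → ℕ} (hf : f.Injective) :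
    (atTop.liminf fun n : ℕ => ENNReal.ofReal ((n : ℝ)⁻¹) *
      partitionEntropy μ (fun x => fun i : Fin n => (f ∘ p) (T^[i] x))) = entropyRate T μ p := by
  unfold entropyRate
  congr with n
  have : (fun x => fun i : Fin n => (f ∘ p) (T^[i] x)) = (fun v i => f (v i)) ∘ itin T p n := rfl
  have hinj : Function.Injective fun (v : Fin n → α) (i : Fin n) => f (v i) := hf.comp_left
  rw [this, partitionEntropy_comp_injective μ _ hinj, partitionEntropy_eq_ofReal,
    ENNReal.ofReal_mul (by positivity)]

lemma entropyRate_le_entropy (T : X → X) (μ : Measure X) [IsProbabilityMeasure μ] {p : X → α}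
    (hp : FibMeas p) : entropyRate T μ p ≤ entropy T μ := by
  let f : α → ℕ := fun a => Fintype.equivFin α a
  have hf : f.Injective := Fin.val_injective.comp (Fintype.equivFin α).injective
  rw [← liminf_partitionEntropy_eq T μ p hf]
  refine le_iSup₂_of_le (f ∘ p) ⟨?_, ?_⟩ le_rfl
  · exact measurable_to_countable' fun n => by
      rw [Set.preimage_comp]; exact hp.preimage _
  · exact (Set.finite_range f).subset (Set.range_comp_subset_range p f)

lemma entropy_le_of_entropyRate_le (T : X → X) (μ : Measure X) [IsProbabilityMeasure μ] {L : ℝ≥0∞}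
    (h : ∀ (r : ℕ) (p : X → Fin r), FibMeas p → entropyRate T μ p ≤ L) : entropy T μ ≤ L := by
  refine iSup₂_le fun p hp => ?_
  obtain ⟨M, hM⟩ := hp.2.bddAbove
  let p' : X → Fin (M + 1) := fun x => ⟨p x, Nat.lt_succ_of_le (hM ⟨x, rfl⟩)⟩
  have h1 : FibMeas p' := fun a => by
    have : p' ⁻¹' {a} = p ⁻¹' {a.1} := by ext; simp [p', Fin.ext_iff]
    rw [this]
    exact hp.1 (measurableSet_singleton _)
  have := h _ p' h1
  rwa [← liminf_partitionEntropy_eq T μ p' Fin.val_injective] at this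

lemma entropyRate_comp_le {T : X → X} (hT : Measurable T) (μ : Measure X) [IsProbabilityMeasure μ]
    {p : X → α} (hp : FibMeas p) (f : α → β) :
    entropyRate T μ (f ∘ p) ≤ entropyRate T μ p := by
  refine liminf_le_liminf (Eventually.of_forall fun n => ?_)
  refine ENNReal.ofReal_le_ofReal (mul_le_mul_of_nonneg_left ?_ (by positivity))
  exact finEntropy_comp_le μ (hp.itin hT n) fun v i => f (v i)

variable {T : X → X} {μ : Measure X} [IsProbabilityMeasure μ]

lemma finEntropy_itin_le (hT : Measurable T) (hinv : Invariant T μ) {p : X → α} (hp : FibMeas p)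
    (n : ℕ) : finEntropy μ (itin T p n) ≤ n * finEntropy μ p := by
  refine (finEntropy_pi_le μ fun i : Fin n => hp.comp_measurable (hT.iterate i)).trans_eq ?_
  have : ∀ i : Fin n, finEntropy μ (fun x => p (T^[i] x)) = finEntropy μ p := fun i =>
    finEntropy_comp_of_invariant hT hinv hp i
  exact (Finset.sum_congr rfl fun i _ => this i).trans (by simp)

lemma finEntropy_itin_add_le (hT : Measurable T) {p : X → α} (hp : FibMeas p) (n k : ℕ) :
    finEntropy μ (itin T p (n + k)) ≤
      finEntropy μ (itin T p n) + k * Real.log (Fintype.card α) := by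
  have h1 : FibMeas fun x => fun j : Fin k => p (T^[n + j] x) :=
    FibMeas.pi fun i : Fin k => hp.comp_measurable (hT.iterate (n + i))
  have h2 := finEntropy_pair_le μ (hp.itin hT n) h1
  have h3 := finEntropy_le_log_card μ h1
  have h4 : itin T p (n + k) = (fun v : (Fin n → α) × (Fin k → α) => Fin.append v.1 v.2) ∘
      fun x => (itin T p n x, fun j : Fin k => p (T^[n + j] x)) := by
    funext x i
    refine Fin.addCases (fun j => ?_) (fun j => ?_) i <;> simp [itin]
  rw [h4]
  refine (finEntropy_comp_le μ ((hp.itin hT n).prodMk h1) _).trans ?_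
  simp only [Fintype.card_pi_const, Nat.cast_pow, Real.log_pow] at h3
  linarith

lemma finEntropy_option_le {r : ℕ} {d : X → Option (Fin r)} (hd : FibMeas d) :
    finEntropy μ d ≤ Real.negMulLog (1 - μ.real (d ⁻¹' {none}ᶜ)) +
      Real.negMulLog (μ.real (d ⁻¹' {none}ᶜ)) + μ.real (d ⁻¹' {none}ᶜ) * Real.log r := by
  have h1 : μ.real (d ⁻¹' {none}) = 1 - μ.real (d ⁻¹' {none}ᶜ) := by
    rw [Set.preimage_compl, probReal_compl_eq_one_sub (hd none)]; ring
  have h2 := sum_negMulLog_le (fun j : Fin r => μ.real (d ⁻¹' {some j})) fun _ => measureReal_nonneg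
  have h3 : ∑ j : Fin r, μ.real (d ⁻¹' {some j}) = μ.real (d ⁻¹' {none}ᶜ) := by
    have := sum_measureReal_fib μ hd Set.univ
    simp only [Set.inter_univ, probReal_univ, Fintype.sum_option] at this
    linarith
  rw [finEntropy, Fintype.sum_option, h1]
  rw [h3, Fintype.card_fin] at h2
  linarith

lemma entropyRate_le_of_close (hT : Measurable T) (hinv : Invariant T μ) {r : ℕ} {p p' : X → Fin r}
    (hp : FibMeas p) (hp' : FibMeas p') {b : X → α} (hb : FibMeas b) {k : ℕ}
    {F : (Fin k → α) → Fin r} (hF : p' = F ∘ itin T b k) {ε : ℝ} (hε : 0 < ε)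
    (hclose : ∀ t, t = μ.real {x | p x ≠ p' x} →
      Real.negMulLog (1 - t) + Real.negMulLog t + t * Real.log r < ε) :
    entropyRate T μ p ≤ entropyRate T μ b + ENNReal.ofReal (2 * ε) := by
  classical
  let d : X → Option (Fin r) := (fun q : Fin r × Fin r => if q.1 = q.2 then none else some q.1) ∘
    fun x => (p x, p' x)
  have hd : FibMeas d := (hp.prodMk hp').comp _
  have hHd : finEntropy μ d ≤ ε := by
    refine (finEntropy_option_le hd).trans (hclose _ ?_).le
    congr 1
    ext x
    simp [d]
  have hstep : ∀ n, finEntropy μ (itin T p n) ≤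
      finEntropy μ (itin T b n) + k * Real.log (Fintype.card α) + n * ε := fun n => by
    have h1 : itin T p n = (fun v : (Fin n → Fin r) × (Fin n → Option (Fin r)) => fun i =>
        (v.2 i).getD (v.1 i)) ∘ fun x => (itin T p' n x, itin T d n x) := by
      funext x i
      simp only [itin, Function.comp_apply, d]
      split_ifs with h <;> simp [h]
    have h2 : itin T p' n = (fun (v : Fin (n + k) → α) (i : Fin n) =>
        F fun j => v ⟨i + j, by omega⟩) ∘ itin T b (n + k) := by
      funext x i
      simp only [itin, hF, Function.comp_apply]
      congr 1
      funext j
      change b (T^[j] (T^[i] x)) = _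
      rw [← Function.iterate_add_apply, add_comm]
    have h3 := finEntropy_comp_le μ ((hp'.itin hT n).prodMk (hd.itin hT n))
      (fun v : (Fin n → Fin r) × (Fin n → Option (Fin r)) => fun i => (v.2 i).getD (v.1 i))
    rw [← h1] at h3
    have h4 := finEntropy_pair_le μ (hp'.itin hT n) (hd.itin hT n)
    have h5 := finEntropy_comp_le μ (hb.itin hT (n + k)) (fun (v : Fin (n + k) → α) (i : Fin n) =>
        F fun j => v ⟨i + j, by omega⟩)
    rw [← h2] at h5
    have h6 := finEntropy_itin_add_le (μ := μ) hT hb n k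
    have h7 := finEntropy_itin_le hT hinv hd n
    have h8 := mul_le_mul_of_nonneg_left hHd (Nat.cast_nonneg (α := ℝ) n)
    linarith
  have hlim : ∀ᶠ n : ℕ in atTop, (n : ℝ)⁻¹ * (k * Real.log (Fintype.card α)) < ε := by
    have := (tendsto_inv_atTop_nhds_zero_nat (𝕜 := ℝ)).mul_const (k * Real.log (Fintype.card α))
    rw [zero_mul] at this
    exact this.eventually_lt_const hε
  calc entropyRate T μ p ≤ atTop.liminf fun n : ℕ =>
        ENNReal.ofReal ((n : ℝ)⁻¹ * finEntropy μ (itin T b n)) + ENNReal.ofReal (2 * ε) := by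
        refine liminf_le_liminf ?_
        filter_upwards [hlim, eventually_gt_atTop 0] with n hn hn0
        have hn' : (0 : ℝ) < n := by exact_mod_cast hn0
        rw [← ENNReal.ofReal_add (mul_nonneg (by positivity) (finEntropy_nonneg _ _))
          (by positivity)]
        refine ENNReal.ofReal_le_ofReal ?_
        have h1 := mul_le_mul_of_nonneg_left (hstep n) (inv_nonneg.2 hn'.le)
        have h2 : (n : ℝ)⁻¹ * (n * ε) = ε := by field_simp
        linarith [mul_add ((n : ℝ)⁻¹) (finEntropy μ (itin T b n) + k * Real.log (Fintype.card α))
          (n * ε), mul_add ((n : ℝ)⁻¹) (finEntropy μ (itin T b n)) (k * Real.log (Fintype.card α))]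
    _ = _ := liminf_add_const _ _ _ (by isBoundedDefault) (by isBoundedDefault)

end Rate

section Names

variable {S : Type*} {A : S → S → Prop}

/-- The partition of the shift space by the index of the first symbol, truncated at `m`. -/
def trunc (e : S → ℕ) (m : ℕ) (x : Space A) : Fin (m + 1) :=
  ⟨min (e (x.1 0)) m, Nat.lt_succ_of_le (min_le_right _ _)⟩

lemma shift_iterate_apply (x : Space A) (n i : ℕ) : ((shift A)^[n] x).1 i = x.1 (i + n) := by
  induction n generalizing x with
  | zero => rfl
  | succ n ih => rw [Function.iterate_succ_apply, ih]; simp [shift, add_assoc]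

/-- The word of the first `k` symbols with indices truncated at `k`. -/
def name (e : S → ℕ) (k : ℕ) : Space A → Fin k → Fin (k + 1) := itin (shift A) (trunc e k) k

lemma name_apply (e : S → ℕ) (k : ℕ) (x : Space A) (i : Fin k) :
    (name e k x i : ℕ) = min (e (x.1 i)) k := by
  simp [name, itin, trunc, shift_iterate_apply]

lemma name_eq_of_le {e : S → ℕ} {k l : ℕ} (hkl : k ≤ l) {x y : Space A}
    (h : name e l x = name e l y) : name e k x = name e k y := by
  funext i
  have := congrArg Fin.val (congrFun h (Fin.castLE hkl i))
  rw [name_apply, name_apply] at this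
  ext
  rw [name_apply, name_apply]
  simp only [Fin.val_castLE] at this
  omega

/-- The largest set determined by names of length `k` and contained in `G`. -/
def nameCore (e : S → ℕ) (k : ℕ) (G : Set (Space A)) : Set (Space A) :=
  name e k ⁻¹' {v | ∀ y, name e k y = v → y ∈ G}

lemma nameCore_mono (e : S → ℕ) (G : Set (Space A)) : Monotone fun k => nameCore e k G :=
  fun _ _ hkl _ hx y hy => hx y (name_eq_of_le hkl hy)

/-- The algebra of sets determined by finitely many truncated symbols. -/
def nameSets (e : S → ℕ) : Set (Set (Space A)) := {t | ∃ k E, t = name e k ⁻¹' E}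

lemma exists_preimage_name_of_le {e : S → ℕ} {k l : ℕ} (hkl : k ≤ l)
    (E : Set (Fin k → Fin (k + 1))) :
    ∃ E', name (A := A) e k ⁻¹' E = name e l ⁻¹' E' := by
  refine ⟨name (A := A) e l '' (name (A := A) e k ⁻¹' E), ?_⟩
  ext x
  constructor
  · exact fun hx => ⟨x, hx, rfl⟩
  · rintro ⟨y, hy, hyx⟩
    rw [Set.mem_preimage, ← name_eq_of_le hkl hyx]
    exact hy

lemma isSetAlgebra_nameSets (e : S → ℕ) : IsSetAlgebra (nameSets (A := A) e) where
  empty_mem := ⟨0, ∅, rfl⟩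
  compl_mem := by
    rintro _ ⟨k, E, rfl⟩
    exact ⟨k, Eᶜ, rfl⟩
  union_mem := by
    rintro _ _ ⟨k, E, rfl⟩ ⟨l, E', rfl⟩
    obtain ⟨F, hF⟩ := exists_preimage_name_of_le (A := A) (e := e) (le_max_left k l) E
    obtain ⟨F', hF'⟩ := exists_preimage_name_of_le (A := A) (e := e) (le_max_right k l) E'
    exact ⟨max k l, F ∪ F', by rw [hF, hF', Set.preimage_union]⟩

variable [TopologicalSpace S]

lemma continuous_coord (i : ℕ) : Continuous fun x : Space A => x.1 i :=
  (continuous_apply i).comp continuous_subtype_val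

lemma continuous_shift : Continuous (shift A) :=
  Continuous.subtype_mk (continuous_pi fun i => continuous_coord (i + 1)) _

lemma measurable_shift : Measurable (shift A) := continuous_shift.measurable

lemma iUnion_nameCore {e : S → ℕ} (he : e.Injective) {G : Set (Space A)} (hG : IsOpen G) :
    ⋃ k, nameCore e k G = G := by
  refine Set.Subset.antisymm (Set.iUnion_subset fun k x hx => hx x rfl) fun x hx => ?_
  obtain ⟨U, hU, rfl⟩ := isOpen_induced_iff.1 hG
  obtain ⟨I, u, hu, hIU⟩ := isOpen_pi_iff.1 hU x.1 hx
  obtain ⟨k, hk⟩ : ∃ k, ∀ i ∈ I, i < k ∧ e (x.1 i) < k := by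
    refine ⟨(I.sup fun i => max i (e (x.1 i))) + 1, fun i hi => ?_⟩
    have := Finset.le_sup (f := fun i => max i (e (x.1 i))) hi
    simp only [max_le_iff] at this
    omega
  refine Set.mem_iUnion.2 ⟨k, fun y hy => hIU fun i hi => ?_⟩
  have h1 := congrArg Fin.val (congrFun hy ⟨i, (hk i hi).1⟩)
  rw [name_apply, name_apply] at h1
  have h2 := (hk i hi).2
  have h3 : y.1 i = x.1 i := he (by simp only at h1; omega)
  rw [h3]
  exact (hu i hi).2

variable [DiscreteTopology S]

lemma fibMeas_trunc (e : S → ℕ) (m : ℕ) : FibMeas (trunc (A := A) e m) := fun a => by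
  have : Continuous (trunc (A := A) e m) :=
    (continuous_of_discreteTopology (f := fun s : S =>
      (⟨min (e s) m, Nat.lt_succ_of_le (min_le_right _ _)⟩ : Fin (m + 1)))).comp
      (continuous_coord 0)
  exact ((isOpen_discrete {a}).preimage this).measurableSet

lemma fibMeas_name (e : S → ℕ) (k : ℕ) : FibMeas (name (A := A) e k) :=
  (fibMeas_trunc e k).itin measurable_shift k

lemma borel_eq_generateFrom_nameSets {e : S → ℕ} (he : e.Injective) :
    borel (Space A) = MeasurableSpace.generateFrom (nameSets e) := by
  refine le_antisymm (MeasurableSpace.generateFrom_le fun G hG => ?_)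
    (MeasurableSpace.generateFrom_le ?_)
  · rw [← iUnion_nameCore he hG]
    exact MeasurableSet.iUnion fun k => MeasurableSpace.measurableSet_generateFrom ⟨k, _, rfl⟩
  · rintro _ ⟨k, E, rfl⟩
    exact (fibMeas_name e k).preimage E

lemma measureDense_nameSets {e : S → ℕ} (he : e.Injective) (μ : Measure (Space A))
    [IsFiniteMeasure μ] : μ.MeasureDense (nameSets e) :=
  .of_generateFrom_isSetAlgebra_finite μ (isSetAlgebra_nameSets e)
    (borel_eq_generateFrom_nameSets he)

lemma exists_approx_partition {e : S → ℕ} (he : e.Injective) (μ : Measure (Space A))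
    [IsProbabilityMeasure μ] {r : ℕ} {p : Space A → Fin r} (hp : FibMeas p) {ε : ℝ} (hε : 0 < ε) :
    ∃ (k : ℕ) (F : (Fin k → Fin (k + 1)) → Fin r), μ.real {x | p x ≠ F (name e k x)} < ε := by
  classical
  obtain ⟨x₀⟩ := μ.nonempty_of_neZero
  have hr : 0 < r := (p x₀).pos
  have hδ : 0 < ε / r := by positivity
  choose t ht htp using fun j => (measureDense_nameSets he μ).approx (p ⁻¹' {j}) (hp j)
    (measure_ne_top _ _) (ε / r) hδ
  choose k E hE using ht
  let K := Finset.univ.sup k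
  choose E' hE' using fun j => exists_preimage_name_of_le (A := A) (e := e)
    (Finset.le_sup (f := k) (Finset.mem_univ j)) (E j)
  have htE : ∀ j, t j = name e K ⁻¹' E' j := fun j => (hE j).trans (hE' j)
  refine ⟨K, fun v => if h : ∃ j, v ∈ E' j then h.choose else p x₀, ?_⟩
  have hsub : {x | p x ≠ if h : ∃ j, name e K x ∈ E' j then h.choose else p x₀} ⊆
      ⋃ j ∈ (Finset.univ : Finset (Fin r)), symmDiff (p ⁻¹' {j}) (t j) := by
    intro x hx
    by_contra hcon
    simp only [Finset.mem_univ, Set.iUnion_true, Set.mem_iUnion, Set.mem_symmDiff, htE,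
      Set.mem_preimage, Set.mem_singleton_iff, not_exists, not_or, not_and, not_not] at hcon
    have hex : ∃ j, name e K x ∈ E' j := ⟨p x, (hcon (p x)).1 rfl⟩
    refine hx ?_
    rw [dif_pos hex]
    exact (hcon _).2 hex.choose_spec
  calc _ ≤ μ.real (⋃ j ∈ (Finset.univ : Finset (Fin r)), symmDiff (p ⁻¹' {j}) (t j)) :=
        measureReal_mono hsub (measure_ne_top _ _)
    _ ≤ ∑ j, μ.real (symmDiff (p ⁻¹' {j}) (t j)) := measureReal_biUnion_finset_le _ _
    _ < ∑ j : Fin r, ε / r := by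
        refine Finset.sum_lt_sum_of_nonempty ⟨p x₀, Finset.mem_univ _⟩ fun j _ => ?_
        exact (ENNReal.toReal_lt_of_lt_ofReal (htp j))
    _ = ε := by
        simp only [Finset.sum_const, Finset.card_univ, Fintype.card_fin, nsmul_eq_mul]
        field_simp

lemma entropy_le_of_entropyRate_trunc_le {e : S → ℕ} (he : e.Injective) (μ : Measure (Space A))
    [IsProbabilityMeasure μ] (hinv : Invariant (shift A) μ) {L : ℝ≥0∞}
    (h : ∀ m, entropyRate (shift A) μ (trunc e m) ≤ L) : entropy (shift A) μ ≤ L := by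
  refine entropy_le_of_entropyRate_le _ _ fun r p hp => ?_
  refine ENNReal.le_of_forall_pos_le_add fun ε hε _ => ?_
  have hcont : Tendsto (fun t : ℝ => Real.negMulLog (1 - t) + Real.negMulLog t + t * Real.log r)
      (𝓝 0) (𝓝 0) := by
    have : Continuous fun t : ℝ =>
        Real.negMulLog (1 - t) + Real.negMulLog t + t * Real.log r := by fun_prop
    simpa using this.tendsto 0
  have hε' : (0 : ℝ) < ε / 2 := by positivity
  obtain ⟨δ, hδ, hball⟩ := Metric.eventually_nhds_iff.1 (hcont.eventually_lt_const hε')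
  obtain ⟨k, F, hF⟩ := exists_approx_partition he μ hp hδ
  have := entropyRate_le_of_close measurable_shift hinv hp ((fibMeas_name e k).comp F)
    (fibMeas_trunc e k) (k := k) (F := F) rfl hε' (by
      rintro t rfl
      refine hball ?_
      rw [Real.dist_eq, sub_zero, abs_of_nonneg measureReal_nonneg]
      exact hF)
  refine this.trans (add_le_add (h k) ?_)
  rw [mul_div_cancel₀ _ two_ne_zero, ENNReal.ofReal_coe_nnreal]

lemma entropyRate_trunc_mono (e : S → ℕ) (μ : Measure (Space A)) [IsProbabilityMeasure μ] :
    Monotone fun m => entropyRate (shift A) μ (trunc e m) := fun k l hkl => by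
  have : trunc (A := A) e k = (fun a : Fin (l + 1) =>
      (⟨min a k, Nat.lt_succ_of_le (min_le_right _ _)⟩ : Fin (k + 1))) ∘ trunc e l := by
    funext x
    simp only [trunc, Function.comp_apply, Fin.mk.injEq]
    omega
  simp only [this]
  exact entropyRate_comp_le measurable_shift μ (fibMeas_trunc e l) _

lemma exists_entropyRate_trunc_ge {e : S → ℕ} (he : e.Injective) (μ : Measure (Space A))
    [IsProbabilityMeasure μ] (hinv : Invariant (shift A) μ) (hent : entropy (shift A) μ ≠ ⊤)
    (k : ℕ) {ε : ℝ} (hε : 0 < ε) :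
    ∃ m ≥ k, entropy (shift A) μ ≤ entropyRate (shift A) μ (trunc e m) + ENNReal.ofReal ε := by
  by_contra! hcon
  have h0 : ENNReal.ofReal ε ≠ 0 := by simpa using hε
  have h1 : entropy (shift A) μ ≤ entropy (shift A) μ - ENNReal.ofReal ε := by
    refine entropy_le_of_entropyRate_trunc_le he μ hinv fun m => ?_
    refine (entropyRate_trunc_mono e μ (le_max_left m k)).trans ?_
    exact ENNReal.le_sub_of_add_le_right ENNReal.ofReal_ne_top (hcon _ (le_max_right m k)).le
  have h2 : 0 < entropy (shift A) μ := zero_le.trans_lt (hcon k le_rfl)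
  exact absurd h1 (not_le.2 (ENNReal.sub_lt_self hent h2.ne' h0))

end Names

/-! ### Towers over Bernoulli shifts -/

section Tower

variable {Ω X : Type*} [MeasurableSpace Ω] [MeasurableSpace X]

/-- The measure obtained by averaging the image of `P` under `π` along `N` steps of `T`. -/
noncomputable def tower (T : X → X) (N : ℕ) (P : Measure Ω) (π : Ω → X) : Measure X :=
  (N : ℝ≥0∞)⁻¹ • ∑ i ∈ Finset.range N, P.map fun ω => T^[i] (π ω)

variable {T : X → X} {N : ℕ} {P : Measure Ω} {π : Ω → X}

lemma measurable_iterate_comp (hT : Measurable T) (hπ : Measurable π) (i : ℕ) :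
    Measurable fun ω => T^[i] (π ω) :=
  (hT.iterate i).comp hπ

lemma tower_apply (hT : Measurable T) (hπ : Measurable π) {s : Set X} (hs : MeasurableSet s) :
    tower T N P π s =
      (N : ℝ≥0∞)⁻¹ * ∑ i ∈ Finset.range N, P ((fun ω => T^[i] (π ω)) ⁻¹' s) := by
  rw [tower, Measure.smul_apply, Measure.finsetSum_apply, smul_eq_mul]
  congr 1
  exact Finset.sum_congr rfl fun i _ => Measure.map_apply (measurable_iterate_comp hT hπ i) hs

lemma isProbabilityMeasure_tower [IsProbabilityMeasure P] (hT : Measurable T) (hπ : Measurable π)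
    (hN : 0 < N) : IsProbabilityMeasure (tower T N P π) := by
  refine ⟨?_⟩
  rw [tower_apply hT hπ MeasurableSet.univ]
  simp only [Set.preimage_univ, measure_univ, Finset.sum_const, Finset.card_range, nsmul_eq_mul,
    mul_one]
  exact ENNReal.inv_mul_cancel (by simpa using hN.ne') (by simp)

lemma measureReal_tower [IsProbabilityMeasure P] (hT : Measurable T) (hπ : Measurable π)
    (s : Set X) :
    (tower T N P π).real s =
      ∑ i ∈ Finset.range N, (N : ℝ)⁻¹ * (P.map fun ω => T^[i] (π ω)).real s := by
  have hm : ∀ i, IsProbabilityMeasure (P.map fun ω => T^[i] (π ω)) := fun i =>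
    Measure.isProbabilityMeasure_map (measurable_iterate_comp hT hπ i).aemeasurable
  rw [measureReal_def, tower, Measure.smul_apply, Measure.finsetSum_apply, smul_eq_mul,
    ENNReal.toReal_mul, ENNReal.toReal_sum fun _ _ => measure_ne_top _ _, Finset.mul_sum]
  simp [measureReal_def]

lemma tower_invariant {θ : Ω → Ω} (hT : Measurable T) (hπ : Measurable π)
    (hθ : MeasurePreserving θ P P) (hN : 0 < N) (hcomm : ∀ ω, π (θ ω) = T^[N] (π ω)) :
    Invariant T (tower T N P π) := by
  refine Measure.ext fun s hs => ?_
  rw [Measure.map_apply hT hs, tower_apply hT hπ (hT hs), tower_apply hT hπ hs]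
  congr 1
  obtain ⟨M, rfl⟩ : ∃ M, N = M + 1 := ⟨N - 1, by omega⟩
  rw [Finset.sum_range_succ, Finset.sum_range_succ']
  congr 1
  · refine Finset.sum_congr rfl fun i _ => ?_
    rw [← Set.preimage_comp]
    congr 2
    funext ω
    simp [Function.iterate_succ_apply']
  · change _ = P (π ⁻¹' s)
    rw [← hθ.measure_preimage (hπ hs).nullMeasurableSet]
    · congr 1
      ext ω
      simp only [Set.mem_preimage, hcomm]
      rw [← Function.iterate_succ_apply' T]

lemma tower_ergodic [IsProbabilityMeasure P] {θ : Ω → Ω} (hT : Measurable T) (hπ : Measurable π)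
    (hθ : Ergodic θ P) (hN : 0 < N) (hcomm : ∀ ω, π (θ ω) = T^[N] (π ω)) :
    Ergodic T (tower T N P π) where
  measurable := hT
  map_eq := tower_invariant hT hπ hθ.toMeasurePreserving hN hcomm
  aeconst_set := fun s hs hinv => by
    have hinv' : ∀ i, T^[i] ⁻¹' s = s := fun i => by
      rw [Set.preimage_iterate_eq]; exact Function.iterate_fixed hinv i
    have h1 : tower T N P π s = P (π ⁻¹' s) := by
      rw [tower_apply hT hπ hs]
      have : ∀ i ∈ Finset.range N, P ((fun ω => T^[i] (π ω)) ⁻¹' s) = P (π ⁻¹' s) :=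
        fun i _ => by
          change P (π ⁻¹' (T^[i] ⁻¹' s)) = _
          rw [hinv']
      rw [Finset.sum_congr rfl this]
      simp only [Finset.sum_const, Finset.card_range, nsmul_eq_mul]
      rw [← mul_assoc, ENNReal.inv_mul_cancel (by simpa using hN.ne') (by simp), one_mul]
    have h2 : θ ⁻¹' (π ⁻¹' s) = π ⁻¹' s := by
      ext ω
      simp only [Set.mem_preimage, hcomm]
      rw [← Set.mem_preimage, hinv']
    have := isProbabilityMeasure_tower (N := N) (P := P) hT hπ hN
    rw [eventuallyConst_set']
    rcases eventuallyConst_set'.1 (hθ.aeconst_set (hπ hs) h2) with h | h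
    · left
      rw [ae_eq_empty] at h ⊢
      rw [h1, h]
    · right
      rw [ae_eq_univ_iff_measure_eq hs.nullMeasurableSet, measure_univ, h1]
      rw [ae_eq_univ_iff_measure_eq (hπ hs).nullMeasurableSet, measure_univ] at h
      exact h

end Tower

section Bernoulli

variable {J : Type*}

/-- The shift on sequences. -/
def seqShift (ω : ℕ → J) : ℕ → J := fun i => ω (i + 1)

lemma seqShift_iterate (n : ℕ) (ω : ℕ → J) : seqShift^[n] ω = fun i => ω (i + n) := by
  induction n generalizing ω with
  | zero => rfl
  | succ n ih => rw [Function.iterate_succ_apply, ih]; funext i; simp [seqShift, add_assoc]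

variable [MeasurableSpace J] (p : Measure J) [IsProbabilityMeasure p]

/-- The Bernoulli measure with marginal `p`. -/
noncomputable abbrev bernoulli : Measure (ℕ → J) := Measure.infinitePi fun _ : ℕ => p

lemma measurePreserving_drop (k : ℕ) :
    MeasurePreserving (fun (ω : ℕ → J) i => ω (i + k)) (bernoulli p) (bernoulli p) :=
  ⟨by fun_prop, Measure.map_infinitePi_infinitePi_of_inj (P := fun _ : ℕ => p)
    (add_left_injective k)⟩

lemma ergodic_seqShift : Ergodic seqShift (bernoulli p) where
  toMeasurePreserving := measurePreserving_drop p 1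
  aeconst_set := fun s hs hinv => by
    have hind : ProbabilityTheory.iIndepFun (fun (i : ℕ) (ω : ℕ → J) => ω i) (bernoulli p) :=
      ProbabilityTheory.iIndepFun_infinitePi (X := fun _ x => x) fun _ => measurable_id
    have hle : ∀ n : ℕ, MeasurableSpace.comap (fun ω : ℕ → J => ω n) inferInstance ≤
        MeasurableSpace.pi := fun n => (measurable_pi_apply n).comap_le
    have htail : MeasurableSet[limsup (fun n : ℕ =>
        MeasurableSpace.comap (fun ω : ℕ → J => ω n) inferInstance) atTop] s := by
      rw [limsup_eq_iInf_iSup_of_nat, MeasurableSpace.measurableSet_iInf]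
      intro n
      have hs' : s = (fun (ω : ℕ → J) i => ω (i + n)) ⁻¹' s := by
        have : seqShift^[n] ⁻¹' s = s := by
          rw [Set.preimage_iterate_eq]; exact Function.iterate_fixed hinv n
        conv_lhs => rw [← this]
        ext ω
        rw [Set.mem_preimage, seqShift_iterate, Set.mem_preimage]
      rw [hs']
      have hm : @Measurable _ _ (⨆ i ≥ n, MeasurableSpace.comap (fun ω : ℕ → J => ω i)
          inferInstance) _ (fun (ω : ℕ → J) i => ω (i + n)) := by
        refine @measurable_pi_lambda _ _ _ (_) _ _ fun i => ?_
        exact (comap_measurable (fun ω : ℕ → J => ω (i + n))).mono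
          (le_iSup₂_of_le (i + n) (Nat.le_add_left n i) le_rfl) le_rfl
      exact hm hs
    rw [eventuallyConst_set']
    rcases ProbabilityTheory.measure_zero_or_one_of_measurableSet_limsup_atTop hle hind.iIndep
      htail with h | h
    · exact .inl (ae_eq_empty.2 h)
    · right
      rw [ae_eq_univ_iff_measure_eq hs.nullMeasurableSet, measure_univ, h]

lemma sum_negMulLog_prod {α : Type*} [Fintype α] (q : α → ℝ) (hq : ∑ a, q a = 1) (k : ℕ) :
    ∑ v : Fin k → α, Real.negMulLog (∏ i, q (v i)) = k * ∑ a, Real.negMulLog (q a) := by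
  induction k with
  | zero => simp
  | succ k ih =>
    have h1 : ∑ v : Fin k → α, ∏ i, q (v i) = 1 := by
      have := Fintype.sum_pow q k
      rw [hq, one_pow] at this
      exact this.symm
    rw [← (Fin.consEquiv fun _ : Fin (k + 1) => α).sum_comp, Fintype.sum_prod_type]
    simp only [Fin.consEquiv_apply, Fin.prod_univ_succ, Fin.cons_zero, Fin.cons_succ,
      Real.negMulLog_mul, Finset.sum_add_distrib, ← Finset.sum_mul, ← Finset.mul_sum, h1, ih, hq]
    push_cast
    ring

lemma finEntropy_bernoulli {α : Type*} [Fintype α] {v : J → α} (hv : FibMeas v) (k : ℕ) :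
    finEntropy (bernoulli p) (fun ω (i : Fin k) => v (ω i)) = k * finEntropy p v := by
  have h1 : ∑ a, p.real (v ⁻¹' {a}) = 1 := by
    simpa using sum_measureReal_fib p hv Set.univ
  rw [finEntropy, finEntropy, ← sum_negMulLog_prod _ h1]
  refine Finset.sum_congr rfl fun a _ => ?_
  congr 1
  have h2 := Measure.map_infinitePi_infinitePi_of_inj (P := fun _ : ℕ => p)
    (Fin.val_injective (n := k))
  rw [Measure.infinitePi_eq_pi (ι := Fin k)] at h2
  have h3 : (fun (ω : ℕ → J) (i : Fin k) => v (ω i)) ⁻¹' {a} =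
      (fun (ω : ℕ → J) (i : Fin k) => ω i) ⁻¹' (Set.univ.pi fun i => v ⁻¹' {a i}) := by
    ext ω; simp [funext_iff]
  rw [h3, measureReal_def, ← Measure.map_apply (by fun_prop)
    (MeasurableSet.univ_pi fun i => hv (a i)), h2, Measure.pi_pi, ENNReal.toReal_prod]
  rfl

end Bernoulli

section TowerEntropy

variable {J X α : Type*} [Fintype J] [MeasurableSpace J] [MeasurableSingletonClass J]
  [MeasurableSpace X] [Fintype α] {p : Measure J} [IsProbabilityMeasure p] {T : X → X} {N : ℕ}
  {π : (ℕ → J) → X} {b : X → α} {c : J → ℕ → α}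

lemma entropyRate_tower_le (hT : Measurable T) (hπ : Measurable π) (hN : 0 < N) (hb : FibMeas b)
    (hc : ∀ ω t, b (T^[t] (π ω)) = c (ω (t / N)) (t % N)) :
    entropyRate T (tower T N (bernoulli p) π) b ≤
      ENNReal.ofReal ((N : ℝ)⁻¹ * finEntropy p id) := by
  have := isProbabilityMeasure_tower (N := N) (P := bernoulli p) hT hπ hN
  have hN' : (0 : ℝ) < N := by exact_mod_cast hN
  have hid : FibMeas (id : J → J) := fun a => measurableSet_singleton a
  have hm : ∀ i, IsProbabilityMeasure ((bernoulli p).map fun ω => T^[i] (π ω)) := fun i =>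
    Measure.isProbabilityMeasure_map (measurable_iterate_comp hT hπ i).aemeasurable
  set L := ∑ i ∈ Finset.range N, Real.negMulLog ((N : ℝ)⁻¹) with hL
  have hstep : ∀ k : ℕ, finEntropy (tower T N (bernoulli p) π) (itin T b (k * N)) ≤
      (k + 1 : ℕ) * finEntropy p id + L := fun k => by
    have h1 := finEntropy_le_of_mixture (Finset.range N) (fun _ => (N : ℝ)⁻¹)
      (fun i => (bernoulli p).map fun ω => T^[i] (π ω)) (tower T N (bernoulli p) π)
      (itin T b (k * N)) (fun _ _ => by positivity) (hb.itin hT _)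
      (fun a => measureReal_tower hT hπ _)
    refine h1.trans (add_le_add ?_ le_rfl)
    have h2 : ∀ i ∈ Finset.range N, (N : ℝ)⁻¹ * finEntropy ((bernoulli p).map fun ω => T^[i] (π ω))
        (itin T b (k * N)) ≤ (N : ℝ)⁻¹ * ((k + 1 : ℕ) * finEntropy p id) := fun i hi => by
      refine mul_le_mul_of_nonneg_left ?_ (by positivity)
      rw [finEntropy_map _ (measurable_iterate_comp hT hπ i) (hb.itin hT _),
        ← finEntropy_bernoulli p hid]
      have hi' := Finset.mem_range.1 hi
      have hlt : ∀ t : Fin (k * N), (t + i) / N < k + 1 := fun t => by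
        rw [Nat.div_lt_iff_lt_mul hN]
        have := t.2
        linarith
      have : (itin T b (k * N) ∘ fun ω => T^[i] (π ω)) =
          (fun (w : Fin (k + 1) → J) (t : Fin (k * N)) =>
            c (w ⟨(t + i) / N, hlt t⟩) ((t + i) % N)) ∘ fun ω (j : Fin (k + 1)) => id (ω j) := by
        funext ω t
        simp only [Function.comp_apply, itin, id]
        rw [← Function.iterate_add_apply, hc]
      rw [this]
      exact finEntropy_comp_le _ (FibMeas.pi fun j : Fin (k + 1) =>
        hid.comp_measurable (measurable_pi_apply (j : ℕ))) _
    refine (Finset.sum_le_sum h2).trans_eq ?_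
    simp only [Finset.sum_const, Finset.card_range, nsmul_eq_mul]
    field_simp
  have htend : Tendsto (fun k : ℕ => k * N) atTop atTop := tendsto_id.atTop_mul_const' hN
  have hlim : Tendsto (fun k : ℕ => ENNReal.ofReal (((k * N : ℕ) : ℝ)⁻¹ *
      ((k + 1 : ℕ) * finEntropy p id + L))) atTop
      (𝓝 (ENNReal.ofReal ((N : ℝ)⁻¹ * finEntropy p id))) := by
    refine (ENNReal.continuous_ofReal.tendsto _).comp ?_
    have h0 := (tendsto_inv_atTop_nhds_zero_nat (𝕜 := ℝ)).mul_const
      ((N : ℝ)⁻¹ * (finEntropy p id + L))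
    have h1 := h0.const_add ((N : ℝ)⁻¹ * finEntropy p id)
    rw [zero_mul, add_zero] at h1
    refine h1.congr' ?_
    filter_upwards [eventually_gt_atTop 0] with k hk
    have hk' : (k : ℝ) ≠ 0 := by positivity
    push_cast
    field_simp
    ring
  calc entropyRate T (tower T N (bernoulli p) π) b
      ≤ atTop.liminf fun k : ℕ => ENNReal.ofReal (((k * N : ℕ) : ℝ)⁻¹ *
        finEntropy (tower T N (bernoulli p) π) (itin T b (k * N))) := by
        rw [entropyRate]
        exact liminf_le_liminf_of_le htend
    _ ≤ atTop.liminf fun k : ℕ => ENNReal.ofReal (((k * N : ℕ) : ℝ)⁻¹ *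
        ((k + 1 : ℕ) * finEntropy p id + L)) :=
        liminf_le_liminf (Eventually.of_forall fun k => ENNReal.ofReal_le_ofReal
          (mul_le_mul_of_nonneg_left (hstep k) (by positivity)))
    _ = _ := hlim.liminf_eq

lemma le_entropyRate_tower (hT : Measurable T) (hπ : Measurable π) (hN : 0 < N) (hb : FibMeas b)
    (hc : ∀ ω t, b (T^[t] (π ω)) = c (ω (t / N)) (t % N)) :
    ENNReal.ofReal ((N : ℝ)⁻¹ * finEntropy p fun j (r : Fin N) => c j r) ≤
      entropyRate T (tower T N (bernoulli p) π) b := by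
  classical
  have := isProbabilityMeasure_tower (N := N) (P := bernoulli p) hT hπ hN
  have hN' : (0 : ℝ) < N := by exact_mod_cast hN
  have hid : FibMeas (id : J → J) := fun a => measurableSet_singleton a
  set V : J → Fin N → α := fun j r => c j r with hV
  have hVm : FibMeas V := hid.comp V
  set H := finEntropy p V
  have hH : 0 ≤ H := finEntropy_nonneg _ _
  have hstep : ∀ n : ℕ, (n / N - 1 : ℕ) * H ≤
      finEntropy (tower T N (bernoulli p) π) (itin T b n) := fun n => by
    set k := n / N - 1 with hk
    have hdrop : finEntropy (bernoulli p)
        ((fun (ω : ℕ → J) (j : Fin k) => V (ω j)) ∘ fun (ω : ℕ → J) i => ω (i + 1)) = k * H := by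
      have h0 : FibMeas fun (ω : ℕ → J) (j : Fin k) => V (ω j) :=
        FibMeas.pi fun j : Fin k => hVm.comp_measurable (measurable_pi_apply (j : ℕ))
      rw [← finEntropy_map _ (measurePreserving_drop p 1).measurable h0,
        (measurePreserving_drop p 1).map_eq, finEntropy_bernoulli p hVm]
    have h1 := sum_finEntropy_le_of_mixture (Finset.range N) (fun _ => (N : ℝ)⁻¹)
      (fun i => (bernoulli p).map fun ω => T^[i] (π ω)) (tower T N (bernoulli p) π)
      (itin T b n) (fun _ _ => by positivity) (by simp [hN'.ne'])
      (fun a => measureReal_tower hT hπ _)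
    refine le_trans ?_ h1
    have h2 : ∀ i ∈ Finset.range N, (N : ℝ)⁻¹ * (k * H) ≤
        (N : ℝ)⁻¹ * finEntropy ((bernoulli p).map fun ω => T^[i] (π ω)) (itin T b n) :=
      fun i hi => by
      refine mul_le_mul_of_nonneg_left ?_ (by positivity)
      have hi' := Finset.mem_range.1 hi
      rw [finEntropy_map _ (measurable_iterate_comp hT hπ i) (hb.itin hT _), ← hdrop]
      have hlt : ∀ (j : Fin k) (r : Fin N), (j + 1) * N + r - i < n := fun j r => by
        have hj := j.2
        have hr := r.2
        have h3 : (k + 1) * N ≤ n := by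
          have h4 : k + 1 = n / N := by omega
          rw [h4]
          exact Nat.div_mul_le_self n N
        have h5 : (j + 1) * N + N ≤ (k + 1) * N := by
          have : ((j : ℕ) + 1 + 1) * N ≤ (k + 1) * N := Nat.mul_le_mul_right N (by omega)
          linarith
        omega
      have hge : ∀ (j : Fin k) (r : Fin N), i ≤ (j + 1) * N + r := fun j r => by
        have : 1 * N ≤ ((j : ℕ) + 1) * N := Nat.mul_le_mul_right N (by omega)
        omega
      have : ((fun (ω : ℕ → J) (j : Fin k) => V (ω j)) ∘ fun (ω : ℕ → J) i => ω (i + 1)) =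
          (fun (w : Fin n → α) (j : Fin k) (r : Fin N) => w ⟨(j + 1) * N + r - i, hlt j r⟩) ∘
            (itin T b n ∘ fun ω => T^[i] (π ω)) := by
        funext ω j r
        simp only [Function.comp_apply, itin, hV]
        rw [← Function.iterate_add_apply, Nat.sub_add_cancel (hge j r), hc,
          mul_comm, Nat.mul_add_mod, Nat.mod_eq_of_lt r.2, Nat.mul_add_div hN, Nat.div_eq_of_lt r.2,
          add_zero]
      rw [this]
      exact finEntropy_comp_le _
        ((hb.itin hT n).comp_measurable (measurable_iterate_comp hT hπ i)) _
    refine le_trans ?_ (Finset.sum_le_sum h2)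
    simp only [Finset.sum_const, Finset.card_range, nsmul_eq_mul]
    field_simp
    rfl
  have hlim : Tendsto (fun n : ℕ => ENNReal.ofReal ((N : ℝ)⁻¹ * H - (n : ℝ)⁻¹ * (2 * H))) atTop
      (𝓝 (ENNReal.ofReal ((N : ℝ)⁻¹ * H))) := by
    refine (ENNReal.continuous_ofReal.tendsto _).comp ?_
    have h0 := (tendsto_inv_atTop_nhds_zero_nat (𝕜 := ℝ)).mul_const (2 * H)
    have h1 := h0.const_sub ((N : ℝ)⁻¹ * H)
    rwa [zero_mul, sub_zero] at h1
  rw [← hlim.liminf_eq, entropyRate]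
  refine liminf_le_liminf ?_
  filter_upwards [eventually_gt_atTop 0] with n hn
  have hn' : (0 : ℝ) < n := by exact_mod_cast hn
  refine ENNReal.ofReal_le_ofReal (le_trans ?_ (mul_le_mul_of_nonneg_left (hstep n)
    (by positivity)))
  have h1 : (n : ℝ) / N - 2 ≤ (n / N - 1 : ℕ) := by
    have h2 := Nat.lt_div_mul_add hN (a := n)
    have h3 : (n : ℝ) < ((n / N : ℕ) : ℝ) * N + N := by exact_mod_cast h2
    have h4 : (n / N : ℕ) ≤ ((n / N - 1 : ℕ) : ℝ) + 1 := by
      have : n / N ≤ n / N - 1 + 1 := by omega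
      exact_mod_cast this
    rw [sub_le_iff_le_add, div_le_iff₀ hN']
    nlinarith
  have h5 := mul_le_mul_of_nonneg_right h1 hH
  have h6 := mul_le_mul_of_nonneg_left h5 (inv_nonneg.2 hn'.le)
  refine le_trans (le_of_eq ?_) h6
  field_simp

end TowerEntropy

/-! ### Loops through a symbol shadowing a given orbit segment -/

section Loops

variable {S : Type*} {A : S → S → Prop}

/-- The point following `x` up to time `t` and `y` afterwards. -/
def splice (x : Space A) (t : ℕ) (y : Space A) (h : x.1 t = y.1 0) : Space A :=
  ⟨fun i => if i < t then x.1 i else y.1 (i - t), fun i => by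
    rcases lt_trichotomy (i + 1) t with hi | hi | hi
    · simpa [hi, Nat.lt_of_succ_lt hi] using x.2 i
    · have := x.2 i
      rw [hi, h] at this
      simpa [← hi] using this
    · have h1 : ¬i < t := by omega
      have h2 : ¬i + 1 < t := by omega
      simpa [h1, h2, show i + 1 - t = i - t + 1 by omega] using y.2 (i - t)⟩

lemma splice_apply_of_le {x : Space A} {t : ℕ} {y : Space A} (h : x.1 t = y.1 0) {i : ℕ}
    (hi : i ≤ t) : (splice x t y h).1 i = x.1 i := by
  rcases hi.lt_or_eq with h1 | rfl
  · simp [splice, h1]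
  · simp [splice, h]

lemma splice_apply_add {x : Space A} {t : ℕ} {y : Space A} (h : x.1 t = y.1 0) (i : ℕ) :
    (splice x t y h).1 (t + i) = y.1 i := by
  simp [splice]

/-- There is an admissible path of length `t` from `a` to `b`. -/
def Conn (A : S → S → Prop) (a : S) (t : ℕ) (b : S) : Prop :=
  ∃ y : Space A, y.1 0 = a ∧ y.1 t = b

lemma Conn.trans {a b c : S} {s t : ℕ} (h₁ : Conn A a s b) (h₂ : Conn A b t c) :
    Conn A a (s + t) c := by
  obtain ⟨x, hx0, hxs⟩ := h₁
  obtain ⟨y, hy0, hyt⟩ := h₂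
  refine ⟨splice x s y (hxs.trans hy0.symm), ?_, ?_⟩
  · rw [splice_apply_of_le _ (Nat.zero_le _), hx0]
  · rw [splice_apply_add, hyt]

lemma exists_conn (htrans : TopTransitive A) (a b : S) : ∃ t, 1 ≤ t ∧ Conn A a t b := by
  obtain ⟨n, hn, x, hx, hx'⟩ := htrans a b
  refine ⟨n, hn, x, hx ⟨0, by simp⟩, ?_⟩
  have := hx' ⟨0, by simp⟩
  rw [shift_iterate_apply] at this
  simpa using this

/-- Uniformly short connections, to and from a fixed symbol, completing orbit segments of a given
length to loops of a common length. -/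
lemma exists_uniform_gap (htrans : TopTransitive A) (a : S) (F : Finset S) :
    ∃ R : ℕ, ∀ n, 1 ≤ n → ∃ N, ∀ b ∈ F, ∀ b' ∈ F, Conn A b (n - 1) b' →
      ∃ s r, s ≤ R ∧ 1 ≤ r ∧ r ≤ R ∧ s + (n - 1) + r = N ∧ Conn A a s b ∧ Conn A b' r a := by
  choose α _ hα using exists_conn htrans a
  choose β hβ1 hβ using fun b => exists_conn htrans b a
  let Λ : AddSubmonoid ℕ :=
    { carrier := {l | Conn A a l a}
      add_mem' := fun h₁ h₂ => h₁.trans h₂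
      zero_mem' := by
        obtain ⟨y, hy, _⟩ := hα a
        exact ⟨y, hy, hy⟩ }
  set d := Nat.setGcd (Λ : Set ℕ) with hd
  have hdvd : ∀ l ∈ Λ, d ∣ l := fun l hl => Nat.setGcd_dvd_of_mem hl
  have hd0 : 0 < d := by
    refine Nat.pos_of_ne_zero fun h => ?_
    have := hdvd _ (hβ a)
    rw [h, zero_dvd_iff] at this
    have := hβ1 a
    omega
  obtain ⟨n₀, hn₀⟩ := Nat.exists_mem_closure_of_ge (Λ : Set ℕ)
  simp only [AddSubmonoid.closure_eq, ← hd] at hn₀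
  set B := ∑ b ∈ F, (α b + β b) with hB
  have hBb : ∀ b ∈ F, α b + β b ≤ B := fun b hb =>
    Finset.single_le_sum (f := fun b => α b + β b) (fun _ _ => Nat.zero_le _) hb
  refine ⟨4 * B + n₀ + d, fun n hn =>
    ⟨d * ((n - 1 + 2 * B + n₀) / d + 1), fun b hb b' hb' hc => ?_⟩⟩
  have h1 : d ∣ α b + (n - 1) + β b' := hdvd _ (((hα b).trans hc).trans (hβ b'))
  have h2 := Nat.lt_mul_div_succ (n - 1 + 2 * B + n₀) hd0
  have h3 := Nat.mul_div_le (n - 1 + 2 * B + n₀) d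
  have h4 := hBb b hb
  have h5 := hBb b' hb'
  set N := d * ((n - 1 + 2 * B + n₀) / d + 1) with hN
  have h6 : N = d * ((n - 1 + 2 * B + n₀) / d) + d := by rw [hN, mul_add, mul_one]
  have h7 : N - (α b + (n - 1) + β b') ∈ Λ :=
    hn₀ _ (by omega) (Nat.dvd_sub (Dvd.intro _ rfl) h1)
  refine ⟨N - (α b + (n - 1) + β b') + α b, β b', by omega, hβ1 _, by omega, by omega,
    Conn.trans h7 (hα b), hβ b'⟩

lemma birkhoff_add {X : Type*} (T : X → X) (f : X → ℝ) (m n : ℕ) (x : X) :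
    birkhoff T f (m + n) x = birkhoff T f m x + birkhoff T f n (T^[m] x) :=
  birkhoffSum_add T f m n x

/-- The distortion of `S_n φ` on cylinders is at most `C`, uniformly in `n`. -/
def BddDistortion (φ : Space A → ℝ) (C : ℝ) : Prop :=
  ∀ n, 1 ≤ n → ∀ x y : Space A, (∀ i < n, x.1 i = y.1 i) →
    |birkhoff (shift A) φ n x - birkhoff (shift A) φ n y| ≤ C

lemma BddDistortion.abs_sub_le {φ : Space A → ℝ} {C : ℝ} (h : BddDistortion φ C) {x y : Space A}
    (hxy : x.1 0 = y.1 0) : |φ x - φ y| ≤ C := by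
  have := h 1 le_rfl x y (fun i hi => by obtain rfl : i = 0 := by omega
                                         exact hxy)
  simpa [birkhoff] using this

lemma abs_birkhoff_le {X : Type*} {T : X → X} {f : X → ℝ} {n : ℕ} {x : X} {M : ℝ}
    (h : ∀ i < n, |f (T^[i] x)| ≤ M) : |birkhoff T f n x| ≤ n * M := by
  refine (Finset.abs_sum_le_sum_abs _ _).trans ?_
  refine (Finset.sum_le_sum fun i hi => h i (Finset.mem_range.1 hi)).trans_eq ?_
  simp

/-- Orbit segments starting and ending in a finite set of symbols are shadowed by loops of a
common length, with uniformly bounded changes of Birkhoff sums. -/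
lemma exists_loop (htrans : TopTransitive A) {φ : Space A → ℝ} {C : ℝ} (hφ : BddDistortion φ C)
    (a : S) (F : Finset S) :
    ∃ (R : ℕ) (K : ℝ), ∀ n, 1 ≤ n → ∃ N, N ≤ n + R ∧ ∀ x : Space A, x.1 0 ∈ F → x.1 (n - 1) ∈ F →
      ∃ (w : Space A) (s : ℕ), s ≤ R ∧ s + n ≤ N ∧ w.1 0 = a ∧ w.1 N = a ∧
        (∀ i < n, w.1 (s + i) = x.1 i) ∧
        ∀ y : Space A, (∀ i < N, y.1 i = w.1 i) →
          |birkhoff (shift A) φ N y - birkhoff (shift A) φ n x| ≤ K := by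
  classical
  obtain ⟨R, hR⟩ := exists_uniform_gap htrans a F
  obtain ⟨_, -, x₀, -, -⟩ := exists_conn htrans a a
  have hex : ∀ b t b', ∃ y : Space A, Conn A b t b' → y.1 0 = b ∧ y.1 t = b' := fun b t b' => by
    by_cases h : Conn A b t b'
    · exact ⟨h.choose, fun _ => h.choose_spec⟩
    · exact ⟨x₀, fun h' => absurd h' h⟩
  choose c hc using hex
  let g : S × ℕ × ℕ → ℝ := fun q => |φ ((shift A)^[q.2.2] (c a q.2.1 q.1))| +
    |φ ((shift A)^[q.2.2] (c q.1 q.2.1 a))|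
  let D := F ×ˢ Finset.range (R + 1) ×ˢ Finset.range (R + 1)
  let M := C + ∑ q ∈ D, g q
  have hg : ∀ b ∈ F, ∀ t ≤ R, ∀ i ≤ R, g (b, t, i) ≤ ∑ q ∈ D, g q := fun b hb t ht i hi =>
    Finset.single_le_sum (f := g) (fun _ _ => by positivity) (by simp [D, hb]; omega)
  have hM0 : 0 ≤ M := add_nonneg ((abs_nonneg _).trans (hφ.abs_sub_le (rfl : x₀.1 0 = x₀.1 0)))
    (Finset.sum_nonneg fun _ _ => by positivity)
  refine ⟨2 * R, R * M + C + R * M, fun n hn => ?_⟩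
  obtain ⟨N, hN⟩ := hR n hn
  by_cases hne : ∃ x : Space A, x.1 0 ∈ F ∧ x.1 (n - 1) ∈ F
  swap
  · exact ⟨0, by omega, fun x h₁ h₂ => absurd ⟨x, h₁, h₂⟩ hne⟩
  refine ⟨N, ?_, fun x hx hx' => ?_⟩
  · obtain ⟨x, h₁, h₂⟩ := hne
    obtain ⟨s, r, h⟩ := hN _ h₁ _ h₂ ⟨x, rfl, rfl⟩
    omega
  obtain ⟨s, r, hs, hr1, hr, hsum, has, hra⟩ := hN _ hx _ hx' ⟨x, rfl, rfl⟩
  obtain ⟨hp0, hps⟩ := hc _ _ _ has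
  obtain ⟨hq0, hqr⟩ := hc _ _ _ hra
  set p := c a s (x.1 0)
  set q := c (x.1 (n - 1)) r a
  have hz : (splice x (n - 1) q hq0.symm).1 0 = x.1 0 := splice_apply_of_le _ (Nat.zero_le _)
  set w := splice p s (splice x (n - 1) q hq0.symm) (hps.trans hz.symm) with hw
  have hw1 : ∀ i ≤ s, w.1 i = p.1 i := fun i hi => splice_apply_of_le _ hi
  have hw2 : ∀ i < n, w.1 (s + i) = x.1 i := fun i hi => by
    rw [hw, splice_apply_add, splice_apply_of_le _ (by omega)]
  have hw3 : ∀ i, w.1 (s + (n - 1 + i)) = q.1 i := fun i => by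
    rw [hw, splice_apply_add, splice_apply_add]
  refine ⟨w, s, by omega, by omega, ?_, ?_, hw2, fun y hy => ?_⟩
  · rw [hw1 0 (Nat.zero_le _), hp0]
  · rw [← hsum, add_assoc, hw3, hqr]
  have hsplit : N = s + n + (r - 1) := by omega
  have e1 : |birkhoff (shift A) φ s y| ≤ R * M := by
    refine (abs_birkhoff_le (M := M) fun i hi => ?_).trans
      (mul_le_mul_of_nonneg_right (by exact_mod_cast hs) hM0)
    have h1 : |φ ((shift A)^[i] y) - φ ((shift A)^[i] p)| ≤ C := hφ.abs_sub_le (by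
      rw [shift_iterate_apply, shift_iterate_apply, zero_add, hy i (by omega), hw1 i hi.le])
    have h2 := hg _ hx s hs i (by omega)
    have h3 : |φ ((shift A)^[i] p)| ≤ g (x.1 0, s, i) := le_add_of_nonneg_right (abs_nonneg _)
    have h4 := abs_add_le (φ ((shift A)^[i] y) - φ ((shift A)^[i] p)) (φ ((shift A)^[i] p))
    rw [sub_add_cancel] at h4
    simp only [M]
    linarith
  have e2 : |birkhoff (shift A) φ (r - 1) ((shift A)^[s + n] y)| ≤ R * M := by
    refine (abs_birkhoff_le (M := M) fun i hi => ?_).trans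
      (mul_le_mul_of_nonneg_right (by exact_mod_cast (by omega : r - 1 ≤ R)) hM0)
    rw [← Function.iterate_add_apply]
    have h1 : |φ ((shift A)^[i + (s + n)] y) - φ ((shift A)^[i + 1] q)| ≤ C := hφ.abs_sub_le (by
      rw [shift_iterate_apply, shift_iterate_apply, zero_add, zero_add, hy _ (by omega), ← hw3]
      exact congrArg w.1 (by omega))
    have h2 := hg _ hx' r hr (i + 1) (by omega)
    have h3 : |φ ((shift A)^[i + 1] q)| ≤ g (x.1 (n - 1), r, i + 1) :=
      le_add_of_nonneg_left (abs_nonneg _)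
    have h4 := abs_add_le (φ ((shift A)^[i + (s + n)] y) - φ ((shift A)^[i + 1] q))
      (φ ((shift A)^[i + 1] q))
    rw [sub_add_cancel] at h4
    simp only [M]
    linarith
  have e3 : |birkhoff (shift A) φ n ((shift A)^[s] y) - birkhoff (shift A) φ n x| ≤ C :=
    hφ n hn _ _ fun i hi => by
      rw [shift_iterate_apply, hy _ (by omega), add_comm, hw2 i hi]
  rw [hsplit, birkhoff_add, birkhoff_add]
  rw [abs_le] at *
  constructor <;> linarith [e1.1, e1.2, e2.1, e2.2, e3.1, e3.2]

/-- Birkhoff sums of the indicator of a set determined by the first `k` symbols change little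
between two points one of which shadows the other. -/
lemma abs_birkhoff_indicator_sub_le {t : Set (Space A)} {k n N s : ℕ} {x y : Space A}
    (ht : ∀ u v : Space A, (∀ i < k, u.1 i = v.1 i) → (u ∈ t ↔ v ∈ t)) (hN : s + n ≤ N)
    (hy : ∀ i < n, y.1 (s + i) = x.1 i) :
    |birkhoff (shift A) (t.indicator 1) N y - birkhoff (shift A) (t.indicator 1) n x| ≤
      (N - n : ℕ) + 2 * k := by
  have hb : ∀ u : Space A, |t.indicator (1 : Space A → ℝ) u| ≤ 1 := fun u => by
    by_cases h : u ∈ t <;> simp [h]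
  have e1 := abs_birkhoff_le (T := shift A) (n := s) (x := y) fun i _ => hb ((shift A)^[i] y)
  have e2 := abs_birkhoff_le (T := shift A) (n := N - (s + n)) (x := (shift A)^[s + n] y)
    fun i _ => hb ((shift A)^[i] ((shift A)^[s + n] y))
  have e3 : |birkhoff (shift A) (t.indicator 1) n ((shift A)^[s] y) -
      birkhoff (shift A) (t.indicator 1) n x| ≤ 2 * k := by
    have hn : n = (n - k) + (n - (n - k)) := by omega
    have e4 := abs_birkhoff_le (T := shift A) (n := n - (n - k))
      (x := (shift A)^[n - k] ((shift A)^[s] y)) fun i _ => hb ((shift A)^[i] _)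
    have e5 := abs_birkhoff_le (T := shift A) (n := n - (n - k))
      (x := (shift A)^[n - k] x) fun i _ => hb ((shift A)^[i] _)
    have e6 : birkhoff (shift A) (t.indicator (1 : Space A → ℝ)) (n - k) ((shift A)^[s] y) =
        birkhoff (shift A) (t.indicator 1) (n - k) x := by
      refine Finset.sum_congr rfl fun i hi => ?_
      have hi' := Finset.mem_range.1 hi
      have := ht ((shift A)^[i] ((shift A)^[s] y)) ((shift A)^[i] x) fun j hj => by
        rw [shift_iterate_apply, shift_iterate_apply, shift_iterate_apply, add_comm,
          hy _ (by omega)]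
      by_cases h : (shift A)^[i] x ∈ t
      · simp [h, this.2 h]
      · simp [h, mt this.1 h]
    have e7 : ((n - (n - k) : ℕ) : ℝ) ≤ k := by exact_mod_cast (by omega : n - (n - k) ≤ k)
    rw [hn, birkhoff_add, birkhoff_add, e6]
    rw [abs_le] at *
    constructor <;> linarith [e4.1, e4.2, e5.1, e5.2]
  have e8 : ((N - n : ℕ) : ℝ) = s + (N - (s + n) : ℕ) := by
    exact_mod_cast (by omega : N - n = s + (N - (s + n)))
  have hsplit : N = s + n + (N - (s + n)) := by omega
  have e9 : birkhoff (shift A) (t.indicator (1 : Space A → ℝ)) N y =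
      birkhoff (shift A) (t.indicator 1) s y +
        birkhoff (shift A) (t.indicator 1) n ((shift A)^[s] y) +
        birkhoff (shift A) (t.indicator 1) (N - (s + n)) ((shift A)^[s + n] y) := by
    conv_lhs => rw [hsplit, birkhoff_add, birkhoff_add]
  rw [e9, e8]
  rw [abs_le] at *
  constructor <;> linarith [e1.1, e1.2, e2.1, e2.2, e3.1, e3.2]

end Loops

/-! ### Ergodic measures generated by random concatenation of loops -/

section Concat

variable {S J : Type*} {A : S → S → Prop} {W : J → Space A} {N : ℕ} {a : S}

/-- The bi-infinite concatenation of the loops `W j` of length `N`. -/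
def concat (W : J → Space A) (hN : 0 < N) (h0 : ∀ j, (W j).1 0 = a) (h1 : ∀ j, (W j).1 N = a)
    (ω : ℕ → J) : Space A :=
  ⟨fun t => (W (ω (t / N))).1 (t % N), fun t => by
    change A ((W (ω (t / N))).1 (t % N)) ((W (ω ((t + 1) / N))).1 ((t + 1) % N))
    have h := (W (ω (t / N))).2 (t % N)
    rcases Nat.lt_or_ge (t % N + 1) N with hlt | hge
    · have e1 : (t + 1) / N = t / N := by
        rw [Nat.div_eq_iff hN]
        have := Nat.div_add_mod' t N
        omega
      have e2 : (t + 1) % N = t % N + 1 := by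
        rw [Nat.add_mod, Nat.mod_eq_of_lt (a := 1) (by omega), Nat.mod_eq_of_lt hlt]
      rwa [e1, e2]
    · have hlt := Nat.mod_lt t hN
      have e3 : t % N + 1 = N := by omega
      have e2 : (t + 1) % N = 0 := by
        rw [← Nat.mod_add_mod, e3, Nat.mod_self]
      rw [e3, h1] at h
      rwa [e2, h0]⟩

variable {hN : 0 < N} {h0 : ∀ j, (W j).1 0 = a} {h1 : ∀ j, (W j).1 N = a}

lemma concat_apply_of_lt (ω : ℕ → J) {i : ℕ} (hi : i < N) :
    (concat W hN h0 h1 ω).1 i = (W (ω 0)).1 i := by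
  simp [concat, Nat.div_eq_of_lt hi, Nat.mod_eq_of_lt hi]

lemma concat_seqShift (ω : ℕ → J) :
    concat W hN h0 h1 (seqShift ω) = (shift A)^[N] (concat W hN h0 h1 ω) := by
  refine Subtype.ext (funext fun t => ?_)
  rw [shift_iterate_apply]
  simp [concat, seqShift, hN]

lemma trunc_shift_concat (e : S → ℕ) (m : ℕ) (ω : ℕ → J) (t : ℕ) :
    trunc e m ((shift A)^[t] (concat W hN h0 h1 ω)) =
      trunc e m ((shift A)^[t % N] (W (ω (t / N)))) := by
  simp only [trunc, shift_iterate_apply, zero_add]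
  rfl

variable [Fintype J] [MeasurableSpace J] [MeasurableSingletonClass J]
  [TopologicalSpace S] [DiscreteTopology S]

lemma measurable_concat {e : S → ℕ} (he : e.Injective) : Measurable (concat W hN h0 h1) := by
  have hm : @Measurable _ _ _ (MeasurableSpace.generateFrom (nameSets e))
      (concat W hN h0 h1) := by
    refine measurable_generateFrom ?_
    rintro _ ⟨k, E, rfl⟩
    have hid : FibMeas (id : J → J) := fun j => measurableSet_singleton j
    have h : FibMeas (name e k ∘ concat W hN h0 h1) := by
      refine FibMeas.pi (g := fun (i : Fin k) ω =>
        trunc e k ((shift A)^[i] (concat W hN h0 h1 ω))) fun i => ?_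
      simp only [trunc_shift_concat]
      exact (hid.comp fun j => trunc e k ((shift A)^[i % N] (W j))).comp_measurable
        (measurable_pi_apply ((i : ℕ) / N))
    exact h.preimage E
  rw [← borel_eq_generateFrom_nameSets he] at hm
  exact hm

variable {p : Measure J} [IsProbabilityMeasure p]

lemma integral_tower_concat {e : S → ℕ} (he : e.Injective) {f : Space A → ℝ} (hf : Measurable f)
    {D : ℝ} (hD : ∀ x y : Space A, x.1 0 = y.1 0 → |f x - f y| ≤ D) {g : J → ℝ} {K : ℝ}
    (hg : ∀ j, ∀ y : Space A, (∀ i < N, y.1 i = (W j).1 i) →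
      |birkhoff (shift A) f N y - g j| ≤ K) :
    Integrable f (tower (shift A) N (bernoulli p) (concat W hN h0 h1)) ∧
      |∫ x, f x ∂(tower (shift A) N (bernoulli p) (concat W hN h0 h1)) -
        (N : ℝ)⁻¹ * ∫ j, g j ∂p| ≤ (N : ℝ)⁻¹ * K := by
  set π := concat W hN h0 h1 with hπdef
  have hπ : Measurable π := measurable_concat he
  have hm : ∀ i, Measurable fun ω => (shift A)^[i] (π ω) :=
    measurable_iterate_comp measurable_shift hπ
  let B := D + ∑ j, ∑ i ∈ Finset.range N, |f ((shift A)^[i] (W j))|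
  have hB : ∀ i < N, ∀ ω, ‖f ((shift A)^[i] (π ω))‖ ≤ B := fun i hi ω => by
    have h2 : |f ((shift A)^[i] (π ω)) - f ((shift A)^[i] (W (ω 0)))| ≤ D := hD _ _ (by
      rw [shift_iterate_apply, shift_iterate_apply, zero_add, concat_apply_of_lt ω hi])
    have h3 : |f ((shift A)^[i] (W (ω 0)))| ≤
        ∑ i ∈ Finset.range N, |f ((shift A)^[i] (W (ω 0)))| :=
      Finset.single_le_sum (f := fun i => |f ((shift A)^[i] (W (ω 0)))|)
        (fun _ _ => abs_nonneg _) (Finset.mem_range.2 hi)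
    have h4 := Finset.single_le_sum (f := fun j => ∑ i ∈ Finset.range N,
      |f ((shift A)^[i] (W j))|) (fun _ _ => Finset.sum_nonneg fun _ _ => abs_nonneg _)
      (Finset.mem_univ (ω 0))
    have h5 := abs_add_le (f ((shift A)^[i] (π ω)) - f ((shift A)^[i] (W (ω 0))))
      (f ((shift A)^[i] (W (ω 0))))
    rw [sub_add_cancel] at h5
    rw [Real.norm_eq_abs]
    simp only [B]
    linarith
  have hint : ∀ i < N, Integrable (fun ω => f ((shift A)^[i] (π ω))) (bernoulli p) := fun i hi =>
    Integrable.of_bound (hf.comp (hm i)).aestronglyMeasurable B (Eventually.of_forall (hB i hi))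
  have hintm : ∀ i ∈ Finset.range N,
      Integrable f ((bernoulli p).map fun ω => (shift A)^[i] (π ω)) := fun i hi =>
    (integrable_map_measure hf.aestronglyMeasurable (hm i).aemeasurable).2
      (hint i (Finset.mem_range.1 hi))
  have hN' : (0 : ℝ) < N := by exact_mod_cast hN
  refine ⟨(integrable_finsetSum_measure.2 hintm).smul_measure (by simpa using hN.ne'), ?_⟩
  have e1 : ∫ x, f x ∂(tower (shift A) N (bernoulli p) π) =
      (N : ℝ)⁻¹ * ∫ ω, birkhoff (shift A) f N (π ω) ∂(bernoulli p) := by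
    rw [tower, integral_smul_measure, integral_finsetSum_measure hintm, ENNReal.toReal_inv,
      ENNReal.toReal_natCast, smul_eq_mul]
    congr 1
    rw [show (fun ω => birkhoff (shift A) f N (π ω)) =
      fun ω => ∑ i ∈ Finset.range N, f ((shift A)^[i] (π ω)) from rfl,
      integral_finsetSum _ fun i hi => hint i (Finset.mem_range.1 hi)]
    exact Finset.sum_congr rfl fun i _ =>
      integral_map (hm i).aemeasurable hf.aestronglyMeasurable
  have hgm : Measurable g := measurable_of_finite g
  have hgint : Integrable g p := Integrable.of_finite
  have hmp : MeasurePreserving (fun ω : ℕ → J => ω 0) (bernoulli p) p :=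
    measurePreserving_eval_infinitePi (fun _ : ℕ => p) 0
  have e2 : ∫ j, g j ∂p = ∫ ω : ℕ → J, g (ω 0) ∂(bernoulli p) := by
    rw [← integral_map (φ := fun ω : ℕ → J => ω 0) hmp.measurable.aemeasurable
      hgm.aestronglyMeasurable, hmp.map_eq]
  have hSint : Integrable (fun ω => birkhoff (shift A) f N (π ω)) (bernoulli p) :=
    integrable_finsetSum _ fun i hi => hint i (Finset.mem_range.1 hi)
  have hgint' : Integrable (fun ω : ℕ → J => g (ω 0)) (bernoulli p) :=
    hmp.integrable_comp_of_integrable hgint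
  rw [e1, e2, ← mul_sub, ← integral_sub hSint hgint', abs_mul, abs_of_pos (inv_pos.2 hN')]
  refine mul_le_mul_of_nonneg_left ?_ (inv_pos.2 hN').le
  have := norm_integral_le_of_norm_le_const (μ := bernoulli p) (C := K)
    (f := fun ω => birkhoff (shift A) f N (π ω) - g (ω 0)) (Eventually.of_forall fun ω =>
      hg (ω 0) (π ω) fun i hi => concat_apply_of_lt ω hi)
  simpa using this

/-- The ergodic measure generated by an independent random sequence of loops of equal length. -/
theorem exists_ergodic_of_loops {e : S → ℕ} (he : e.Injective) (p : Measure J)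
    [IsProbabilityMeasure p] (W : J → Space A) (hN : 0 < N) (h0 : ∀ j, (W j).1 0 = a)
    (h1 : ∀ j, (W j).1 N = a) :
    ∃ ν : ProbabilityMeasure (Space A), Ergodic (shift A) (ν : Measure (Space A)) ∧
      entropy (shift A) (ν : Measure (Space A)) ≤ ENNReal.ofReal ((N : ℝ)⁻¹ * finEntropy p id) ∧
      (∀ m, ENNReal.ofReal ((N : ℝ)⁻¹ * finEntropy p fun j (r : Fin N) =>
        trunc e m ((shift A)^[r] (W j))) ≤ entropy (shift A) (ν : Measure (Space A))) ∧
      ∀ f : Space A → ℝ, Measurable f →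
        (∃ D, ∀ x y : Space A, x.1 0 = y.1 0 → |f x - f y| ≤ D) → ∀ (g : J → ℝ) (K : ℝ),
        (∀ j, ∀ y : Space A, (∀ i < N, y.1 i = (W j).1 i) →
          |birkhoff (shift A) f N y - g j| ≤ K) →
        Integrable f (ν : Measure (Space A)) ∧
          |∫ x, f x ∂(ν : Measure (Space A)) - (N : ℝ)⁻¹ * ∫ j, g j ∂p| ≤ (N : ℝ)⁻¹ * K := by
  set π := concat W hN h0 h1 with hπdef
  have hπ : Measurable π := measurable_concat he
  have hprob := isProbabilityMeasure_tower (N := N) (P := bernoulli p) measurable_shift hπ hN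
  have herg := tower_ergodic measurable_shift hπ (ergodic_seqShift p) hN
    (fun ω => concat_seqShift (hN := hN) (h0 := h0) (h1 := h1) ω)
  refine ⟨⟨tower (shift A) N (bernoulli p) π, hprob⟩, herg, ?_, fun m => ?_, ?_⟩
  · exact entropy_le_of_entropyRate_trunc_le he _ herg.map_eq fun m =>
      entropyRate_tower_le (c := fun j r => trunc e m ((shift A)^[r] (W j))) measurable_shift hπ hN
        (fibMeas_trunc e m) fun ω t => trunc_shift_concat e m ω t
  · exact (le_entropyRate_tower (c := fun j r => trunc e m ((shift A)^[r] (W j))) measurable_shift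
      hπ hN (fibMeas_trunc e m) fun ω t => trunc_shift_concat e m ω t).trans
      (entropyRate_le_entropy _ _ (fibMeas_trunc e m))
  · rintro f hf ⟨D, hD⟩ g K hg
    exact integral_tower_concat he hf hD hg

end Concat

/-! ### Integrals with respect to invariant and conditional measures -/

/-- Each fibre meeting `G` contains a point of `G` nearly maximizing `f` there. -/
lemma exists_representatives {Ω U : Type*} (u : Ω → U) {G : Set Ω} (hG : G.Nonempty) {f : Ω → ℝ}
    {B : ℝ} (hB : ∀ x ∈ G, f x ≤ B) :
    ∃ r : U → Ω, (∀ v, r v ∈ G) ∧ ∀ x ∈ G, u (r (u x)) = u x ∧ f x ≤ f (r (u x)) + 1 := by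
  classical
  obtain ⟨x₀, hx₀⟩ := hG
  have key : ∀ v, ∃ y ∈ G, ∀ x ∈ G, u x = v → u y = v ∧ f x ≤ f y + 1 := fun v => by
    by_cases hv : (G ∩ u ⁻¹' {v}).Nonempty
    · have hbd : BddAbove (f '' (G ∩ u ⁻¹' {v})) :=
        ⟨B, by rintro _ ⟨x, hx, rfl⟩; exact hB x hx.1⟩
      obtain ⟨_, ⟨y, hy, rfl⟩, hlt⟩ := exists_lt_of_lt_csSup (hv.image f)
        (sub_one_lt (sSup (f '' (G ∩ u ⁻¹' {v}))))
      refine ⟨y, hy.1, fun x hx hxv => ⟨hy.2, ?_⟩⟩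
      have := le_csSup hbd (mem_image_of_mem f (⟨hx, hxv⟩ : x ∈ G ∩ u ⁻¹' {v}))
      linarith
    · exact ⟨x₀, hx₀, fun x hx hxv => absurd ⟨x, hx, hxv⟩ hv⟩
  choose r hr hr' using key
  exact ⟨r, hr, fun x hx => hr' _ x hx rfl⟩

section Integrals

open ProbabilityTheory

variable {Ω : Type*} [MeasurableSpace Ω] {μ : Measure Ω}

lemma integrable_birkhoff {T : Ω → Ω} (hT : Measurable T) (hinv : Invariant T μ) {f : Ω → ℝ}
    (hf : Integrable f μ) (n : ℕ) : Integrable (birkhoff T f n) μ :=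
  integrable_finsetSum _ fun i _ =>
    ((⟨hT, hinv⟩ : MeasurePreserving T μ μ).iterate i).integrable_comp_of_integrable hf

lemma integral_birkhoff {T : Ω → Ω} (hT : Measurable T) (hinv : Invariant T μ) {f : Ω → ℝ}
    (hf : Integrable f μ) (n : ℕ) : ∫ x, birkhoff T f n x ∂μ = n * ∫ x, f x ∂μ := by
  have hmp : ∀ i, MeasurePreserving T^[i] μ μ := fun i =>
    (⟨hT, hinv⟩ : MeasurePreserving T μ μ).iterate i
  simp only [birkhoff]
  rw [integral_finsetSum (f := fun i x => f (T^[i] x)) _ fun i _ =>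
    (hmp i).integrable_comp_of_integrable hf]
  have : ∀ i, ∫ x, f (T^[i] x) ∂μ = ∫ x, f x ∂μ := fun i => by
    rw [← integral_map (hmp i).measurable.aemeasurable
      (by rw [(hmp i).map_eq]; exact hf.aestronglyMeasurable), (hmp i).map_eq]
  simp [this]

lemma measureReal_mul_integral_cond [IsFiniteMeasure μ] {G : Set Ω} (hG : μ G ≠ 0) (f : Ω → ℝ) :
    μ.real G * ∫ x, f x ∂(cond μ G) = ∫ x in G, f x ∂μ := by
  rw [ProbabilityTheory.cond, integral_smul_measure, smul_eq_mul, ← mul_assoc, measureReal_def,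
    ENNReal.toReal_inv,
    mul_inv_cancel₀, one_mul]
  exact (ENNReal.toReal_pos hG (measure_ne_top _ _)).ne'

lemma integrable_cond [IsFiniteMeasure μ] {G : Set Ω} (hG : μ G ≠ 0) {f : Ω → ℝ}
    (hf : Integrable f μ) : Integrable f (cond μ G) :=
  hf.restrict.smul_measure (ENNReal.inv_ne_top.2 hG)

/-- Conditioning on a set of large measure hardly changes the integral of a bounded function. -/
lemma abs_integral_cond_sub_le [IsProbabilityMeasure μ] {G : Set Ω} (hGm : MeasurableSet G)
    (hG : μ G ≠ 0) {f : Ω → ℝ} (hf : Integrable f μ) {B : ℝ} (hB : ∀ x, |f x| ≤ B) :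
    |∫ x, f x ∂(cond μ G) - ∫ x, f x ∂μ| ≤ 2 * B * μ.real Gᶜ := by
  have h1 := measureReal_mul_integral_cond hG f
  have h2 := integral_add_compl hGm hf
  have h3 : |∫ x in Gᶜ, f x ∂μ| ≤ B * μ.real Gᶜ := by
    simpa using norm_setIntegral_le_of_norm_le_const (f := f) (C := B) (measure_lt_top μ Gᶜ)
      fun x _ => hB x
  have hprob := cond_isProbabilityMeasure hG
  have h4 : |∫ x, f x ∂(cond μ G)| ≤ B := by
    simpa using norm_integral_le_of_norm_le_const (μ := cond μ G) (f := f) (C := B)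
      (Eventually.of_forall hB)
  have h5 : μ.real Gᶜ = 1 - μ.real G := probReal_compl_eq_one_sub hGm
  have h6 : ∫ x, f x ∂(cond μ G) - ∫ x, f x ∂μ =
      μ.real Gᶜ * ∫ x, f x ∂(cond μ G) - ∫ x in Gᶜ, f x ∂μ := by
    rw [← h2, ← h1, h5]; ring
  have h7 : |μ.real Gᶜ * ∫ x, f x ∂(cond μ G)| ≤ μ.real Gᶜ * B := by
    rw [abs_mul, abs_of_nonneg measureReal_nonneg]
    gcongr
  rw [h6]
  have := abs_sub (μ.real Gᶜ * ∫ x, f x ∂(cond μ G)) (∫ x in Gᶜ, f x ∂μ)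
  linarith

/-- A lower bound for the conditional mean of a function bounded above. -/
lemma le_measureReal_mul_integral_cond [IsProbabilityMeasure μ] {G : Set Ω}
    (hGm : MeasurableSet G) (hG : μ G ≠ 0) {f : Ω → ℝ} (hf : Integrable f μ) {B : ℝ}
    (hB : ∀ x, f x ≤ B) :
    ∫ x, f x ∂μ - B * μ.real Gᶜ ≤ μ.real G * ∫ x, f x ∂(cond μ G) := by
  rw [measureReal_mul_integral_cond hG, ← integral_add_compl hGm hf]
  have : ∫ x in Gᶜ, f x ∂μ ≤ ∫ _ in Gᶜ, B ∂μ :=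
    integral_mono hf.restrict (integrable_const _) hB
  simp only [integral_const, measureReal_restrict_apply_univ, smul_eq_mul] at this
  linarith

end Integrals

/-! ### Randomly labelled blocks -/

section Labelled

variable {Ω U : Type*} [MeasurableSpace Ω] [MeasurableSpace U]

/-- The law of a label in `Bool`, with probability `θ` of `true`, together with `u`. -/
noncomputable def labelled (θ : ℝ) (μ : Measure Ω) (u : Ω → U) : Measure (Bool × U) :=
  ENNReal.ofReal θ • μ.map (fun x => (true, u x)) +
    ENNReal.ofReal (1 - θ) • μ.map (fun x => (false, u x))

variable {θ : ℝ} {μ : Measure Ω} {u : Ω → U}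

lemma map_labelled (h0 : 0 ≤ θ) (h1 : θ ≤ 1) (hu : Measurable u) {V : Type*} [MeasurableSpace V]
    {κ : Bool × U → V} (hκm : Measurable κ) {v : Ω → V} (hκ : ∀ b, ∀ᵐ x ∂μ, κ (b, u x) = v x) :
    (labelled θ μ u).map κ = μ.map v := by
  have hb : ∀ b, (μ.map fun x => (b, u x)).map κ = μ.map v := fun b => by
    rw [Measure.map_map hκm (measurable_const.prodMk hu)]
    exact Measure.map_congr (hκ b)
  rw [labelled, Measure.map_add _ _ hκm, Measure.map_smul, Measure.map_smul, hb, hb, ← add_smul,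
    ← ENNReal.ofReal_add h0 (by linarith)]
  simp

lemma isProbabilityMeasure_labelled [IsProbabilityMeasure μ] (h0 : 0 ≤ θ) (h1 : θ ≤ 1)
    (hu : Measurable u) : IsProbabilityMeasure (labelled θ μ u) := by
  have h := map_labelled (μ := μ) h0 h1 hu (κ := fun _ => ()) measurable_const (v := fun _ => ())
    fun b => Eventually.of_forall fun x => rfl
  have h2 := congrArg (fun m : Measure Unit => m Set.univ) h
  simp only [Measure.map_apply measurable_const MeasurableSet.univ, Set.preimage_univ,
    measure_univ] at h2
  exact ⟨h2⟩

variable [Fintype U] [MeasurableSingletonClass U]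

lemma finEntropy_labelled (h0 : 0 ≤ θ) (h1 : θ ≤ 1) (hu : Measurable u)
    {κ : Bool × U → U} (hκ : ∀ b, ∀ᵐ x ∂μ, κ (b, u x) = u x) :
    finEntropy (labelled θ μ u) κ = finEntropy μ u := by
  have hid : FibMeas (id : U → U) := fun v => measurableSet_singleton v
  have hκm : Measurable κ := measurable_of_finite κ
  have h := finEntropy_map (labelled θ μ u) hκm hid
  rw [map_labelled h0 h1 hu hκm hκ, finEntropy_map μ hu hid] at h
  exact h.symm

variable [IsProbabilityMeasure μ]

lemma integral_labelled (h0 : 0 ≤ θ) (h1 : θ ≤ 1) (hu : Measurable u)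
    (g : Bool × U → ℝ) :
    ∫ j, g j ∂(labelled θ μ u) =
      θ * ∫ x, g (true, u x) ∂μ + (1 - θ) * ∫ x, g (false, u x) ∂μ := by
  have hm : ∀ b : Bool, Measurable fun x => (b, u x) := fun b => measurable_const.prodMk hu
  have hp : ∀ b : Bool, IsProbabilityMeasure (μ.map fun x => (b, u x)) := fun b =>
    Measure.isProbabilityMeasure_map (hm b).aemeasurable
  have hg : Measurable g := measurable_of_finite g
  rw [labelled, integral_add_measure, integral_smul_measure, integral_smul_measure,
    integral_map (hm true).aemeasurable hg.aestronglyMeasurable,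
    integral_map (hm false).aemeasurable hg.aestronglyMeasurable, ENNReal.toReal_ofReal h0,
    ENNReal.toReal_ofReal (by linarith), smul_eq_mul, smul_eq_mul]
  · exact (Integrable.of_finite).smul_measure ENNReal.ofReal_ne_top
  · exact (Integrable.of_finite).smul_measure ENNReal.ofReal_ne_top

lemma finEntropy_labelled_id_le (h0 : 0 ≤ θ) (h1 : θ ≤ 1)
    (hu : Measurable u) :
    finEntropy (labelled θ μ u) id ≤ finEntropy μ u + Real.log 2 := by
  have hp := isProbabilityMeasure_labelled (μ := μ) h0 h1 hu
  have hid : FibMeas (id : Bool × U → Bool × U) := fun v => measurableSet_singleton v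
  have h := finEntropy_pair_le (labelled θ μ u) (hid.comp Prod.fst) (hid.comp Prod.snd)
  have h2 := finEntropy_le_log_card (labelled θ μ u) (hid.comp Prod.fst)
  have h3 := finEntropy_labelled (μ := μ) (κ := Prod.snd) h0 h1 hu
    fun b => Eventually.of_forall fun x => rfl
  simp only [Fintype.card_bool, Nat.cast_ofNat] at h2
  have h4 : finEntropy (labelled θ μ u) id ≤ finEntropy (labelled θ μ u) (Prod.fst ∘ id) +
    finEntropy (labelled θ μ u) (Prod.snd ∘ id) := h
  simp only [Function.comp_id] at h2 h4
  linarith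

end Labelled

/-! ### Ergodic measures from labelled blocks -/

section Blocks

variable {S : Type*} {A : S → S → Prop} {e : S → ℕ}

lemma mem_preimage_name_iff {k : ℕ} (E : Set (Fin k → Fin (k + 1))) {x y : Space A}
    (h : ∀ i < k, x.1 i = y.1 i) : x ∈ name e k ⁻¹' E ↔ y ∈ name e k ⁻¹' E := by
  have : name e k x = name e k y := funext fun i => Fin.ext <| by
    rw [name_apply, name_apply, h i i.2]
  rw [Set.mem_preimage, Set.mem_preimage, this]

lemma name_shift_eq {k m n i : ℕ} (hkm : k ≤ m) (hi : i + k ≤ n) {x y : Space A}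
    (h : itin (shift A) (trunc e m) n x = itin (shift A) (trunc e m) n y) :
    name e k ((shift A)^[i] x) = name e k ((shift A)^[i] y) := by
  refine funext fun j => Fin.ext ?_
  have := congrArg Fin.val (congrFun h ⟨i + j, by omega⟩)
  simp only [itin, trunc, shift_iterate_apply, zero_add] at this
  rw [name_apply, name_apply, shift_iterate_apply, shift_iterate_apply, add_comm (j : ℕ) i]
  omega

lemma abs_indicator_sub_le_one {X : Type*} (t : Set X) (x y : X) :
    |t.indicator (1 : X → ℝ) x - t.indicator 1 y| ≤ 1 := by
  by_cases h : x ∈ t <;> by_cases h' : y ∈ t <;> simp [h, h']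

lemma abs_birkhoff_indicator_sub_le_of_itin_eq {k m n : ℕ} (hkm : k ≤ m)
    (E : Set (Fin k → Fin (k + 1))) {x y : Space A}
    (h : itin (shift A) (trunc e m) n x = itin (shift A) (trunc e m) n y) :
    |birkhoff (shift A) ((name e k ⁻¹' E).indicator 1) n x -
      birkhoff (shift A) ((name e k ⁻¹' E).indicator 1) n y| ≤ k := by
  rw [birkhoff, birkhoff, ← Finset.sum_sub_distrib]
  refine (Finset.abs_sum_le_sum_abs _ _).trans ?_
  have hle : ∀ i ∈ Finset.range n, |(name e k ⁻¹' E).indicator (1 : Space A → ℝ) ((shift A)^[i] x) -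
      (name e k ⁻¹' E).indicator 1 ((shift A)^[i] y)| ≤ if n - k ≤ i then (1 : ℝ) else 0 := by
    intro i hi
    rw [Finset.mem_range] at hi
    split_ifs with hc
    · exact abs_indicator_sub_le_one _ _ _
    · have : (shift A)^[i] x ∈ name e k ⁻¹' E ↔ (shift A)^[i] y ∈ name e k ⁻¹' E := by
        rw [Set.mem_preimage, Set.mem_preimage, name_shift_eq hkm (by omega) h]
      by_cases hy : (shift A)^[i] y ∈ name e k ⁻¹' E
      · rw [Set.indicator_of_mem (this.2 hy), Set.indicator_of_mem hy]; simp
      · rw [Set.indicator_of_notMem (mt this.1 hy), Set.indicator_of_notMem hy]; simp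
  refine (Finset.sum_le_sum hle).trans ?_
  rw [← Finset.sum_filter, Finset.sum_const, nsmul_eq_mul, mul_one, Nat.cast_le]
  have : (Finset.range n).filter (fun i => n - k ≤ i) ⊆ Finset.Ico (n - k) n := fun i hi => by
    simp only [Finset.mem_filter, Finset.mem_range] at hi
    simp [hi]
  have := Finset.card_le_card this
  rw [Nat.card_Ico] at this
  omega

variable [TopologicalSpace S] [DiscreteTopology S]

/-- The ergodic measure generated by random loops through representatives of the blocks of `P`. -/
theorem exists_ergodic_of_representatives (he : e.Injective) {φ : Space A → ℝ}
    (hφ : Measurable φ) {D : ℝ} (hD : BddDistortion φ D) (P : Measure (Space A))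
    [IsProbabilityMeasure P] {m n N R : ℕ} {K : ℝ} {a : S} {F : Finset S} (hn : 1 ≤ n)
    (hN : N ≤ n + R)
    (hloop : ∀ x : Space A, x.1 0 ∈ F → x.1 (n - 1) ∈ F →
      ∃ (w : Space A) (s : ℕ), s ≤ R ∧ s + n ≤ N ∧ w.1 0 = a ∧ w.1 N = a ∧
        (∀ i < n, w.1 (s + i) = x.1 i) ∧
        ∀ y : Space A, (∀ i < N, y.1 i = w.1 i) →
          |birkhoff (shift A) φ N y - birkhoff (shift A) φ n x| ≤ K)
    (r : Bool → (Fin n → Fin (m + 1)) → Space A)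
    (hr : ∀ b v, (r b v).1 0 ∈ F ∧ (r b v).1 (n - 1) ∈ F)
    (hru : ∀ b, ∀ᵐ x ∂P, itin (shift A) (trunc e m) n (r b (itin (shift A) (trunc e m) n x)) =
      itin (shift A) (trunc e m) n x)
    {θ : ℝ} (hθ0 : 0 ≤ θ) (hθ1 : θ ≤ 1) :
    n ≤ N ∧ ∃ ν : ProbabilityMeasure (Space A), Ergodic (shift A) (ν : Measure (Space A)) ∧
      entropy (shift A) (ν : Measure (Space A)) ≤ ENNReal.ofReal ((N : ℝ)⁻¹ *
        (finEntropy P (itin (shift A) (trunc e m) n) + Real.log 2)) ∧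
      ENNReal.ofReal ((N : ℝ)⁻¹ * (finEntropy P (itin (shift A) (trunc e m) n) -
        Real.log (R + 1))) ≤ entropy (shift A) (ν : Measure (Space A)) ∧
      Integrable φ (ν : Measure (Space A)) ∧
      |∫ x, φ x ∂(ν : Measure (Space A)) - (N : ℝ)⁻¹ *
        (θ * ∫ x, birkhoff (shift A) φ n (r true (itin (shift A) (trunc e m) n x)) ∂P +
          (1 - θ) * ∫ x, birkhoff (shift A) φ n (r false (itin (shift A) (trunc e m) n x)) ∂P)|
        ≤ (N : ℝ)⁻¹ * K ∧
      ∀ k ≤ m, ∀ E : Set (Fin k → Fin (k + 1)),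
        |(ν : Measure (Space A)).real (name e k ⁻¹' E) - (N : ℝ)⁻¹ *
          ∫ x, birkhoff (shift A) ((name e k ⁻¹' E).indicator 1) n x ∂P| ≤
            (N : ℝ)⁻¹ * (R + 3 * k) := by
  set u : Space A → (Fin n → Fin (m + 1)) := itin (shift A) (trunc e m) n with hu
  have huf : FibMeas u := (fibMeas_trunc e m).itin measurable_shift n
  have hum : Measurable u := measurable_to_countable' huf
  choose w s hs hsn hw0 hwN hws hwφ using fun j : Bool × (Fin n → Fin (m + 1)) =>
    hloop (r j.1 j.2) (hr j.1 j.2).1 (hr j.1 j.2).2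
  have hnN : n ≤ N := (Nat.le_add_left _ _).trans (hsn (true, fun _ => 0))
  have hp := isProbabilityMeasure_labelled (μ := P) hθ0 hθ1 hum
  obtain ⟨ν, herg, hle, hge, hint⟩ := exists_ergodic_of_loops he (labelled θ P u) w
    (hn.trans hnN) hw0 hwN
  have hNpos : (0 : ℝ) ≤ (N : ℝ)⁻¹ := by positivity
  refine ⟨hnN, ν, herg, hle.trans (ENNReal.ofReal_le_ofReal (mul_le_mul_of_nonneg_left
    (finEntropy_labelled_id_le hθ0 hθ1 hum) hNpos)), le_trans (ENNReal.ofReal_le_ofReal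
    (mul_le_mul_of_nonneg_left ?_ hNpos)) (hge m), ?_⟩
  · have hid : FibMeas (id : Bool × (Fin n → Fin (m + 1)) → _) := fun v =>
      measurableSet_singleton v
    set V : Bool × (Fin n → Fin (m + 1)) → (Fin N → Fin (m + 1)) := fun j i =>
      trunc e m ((shift A)^[i] (w j)) with hV
    let σ : Bool × (Fin n → Fin (m + 1)) → Fin (R + 1) := fun j => ⟨s j, by have := hs j; omega⟩
    have h1 := finEntropy_labelled (κ := fun j => u (r j.1 j.2)) hθ0 hθ1 hum hru
    let f : (Fin N → Fin (m + 1)) × Fin (R + 1) → (Fin n → Fin (m + 1)) := fun v i =>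
      if h : (v.2 : ℕ) + i < N then v.1 ⟨v.2 + i, h⟩ else 0
    have h2 : (fun j => u (r j.1 j.2)) = f ∘ fun j => (V j, σ j) := by
      funext j i
      have hlt : s j + i < N := by have := hsn j; omega
      have hlt' : ((σ j : ℕ)) + i < N := hlt
      simp only [Function.comp, f, hlt', dif_pos, hV, hu, itin]
      simp only [trunc, shift_iterate_apply, zero_add, σ, hws j i i.2]
    have h3 := finEntropy_comp_le (labelled θ P u) ((hid.comp V).prodMk (hid.comp σ)) f
    have h4 := finEntropy_pair_le (labelled θ P u) (hid.comp V) (hid.comp σ)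
    have h5 := finEntropy_le_log_card (labelled θ P u) (hid.comp σ)
    simp only [Fintype.card_fin, Nat.cast_add, Nat.cast_one] at h5
    rw [h2] at h1
    simp only [Function.comp_id, Function.comp_apply, id] at h3 h4 h5
    change finEntropy (labelled θ P u) (f ∘ fun j => (V j, σ j)) ≤ _ at h3
    change finEntropy (labelled θ P u) (fun j => (V j, σ j)) ≤
      finEntropy (labelled θ P u) V + finEntropy (labelled θ P u) σ at h4
    linarith
  · have hφν := hint φ hφ ⟨D, fun x y h => hD.abs_sub_le h⟩
      (fun j => birkhoff (shift A) φ n (r j.1 j.2)) K hwφ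
    rw [integral_labelled hθ0 hθ1 hum] at hφν
    refine ⟨hφν.1, hφν.2, fun k hk E => ?_⟩
    set t : Set (Space A) := name e k ⁻¹' E with ht
    have htm : MeasurableSet t := (fibMeas_name e k).preimage E
    have htν := (hint (t.indicator 1) (measurable_one.indicator htm)
      ⟨1, fun x y _ => abs_indicator_sub_le_one t x y⟩
      (fun j => birkhoff (shift A) (t.indicator 1) n (r j.1 j.2)) (R + 2 * k) fun j y hy => by
        have h := abs_birkhoff_indicator_sub_le (x := r j.1 j.2) (y := y) (t := t) (k := k)
          (fun u v huv => mem_preimage_name_iff E huv) (hsn j) fun i hi => by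
            have := hsn j
            rw [hy _ (by omega), hws j i hi]
        have h' : ((N - n : ℕ) : ℝ) ≤ R := by
          rw [Nat.cast_le]; omega
        linarith).2
    rw [integral_labelled hθ0 hθ1 hum, integral_indicator_one htm] at htν
    have hintt : Integrable (fun x => birkhoff (shift A) (t.indicator 1) n x) P := by
      refine Integrable.of_bound (C := n * 1) ?_ (Eventually.of_forall fun x =>
        abs_birkhoff_le fun i _ => ?_)
      · refine (Finset.measurable_sum _ fun i _ => ?_).aestronglyMeasurable
        exact (measurable_one.indicator htm).comp (measurable_shift.iterate i)
      · by_cases h : (shift A)^[i] x ∈ t <;> simp [h]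
    have hb : ∀ b, |∫ x, birkhoff (shift A) (t.indicator 1) n (r b (u x)) ∂P -
        ∫ x, birkhoff (shift A) (t.indicator 1) n x ∂P| ≤ k := fun b => by
      have hi : Integrable (fun x => birkhoff (shift A) (t.indicator 1) n (r b (u x))) P := by
        have : Integrable (fun v => birkhoff (shift A) (t.indicator 1) n (r b v)) (P.map u) := by
          have := Measure.isProbabilityMeasure_map (μ := P) hum.aemeasurable
          exact Integrable.of_finite
        exact this.comp_measurable hum
      rw [← integral_sub hi hintt]
      simpa using norm_integral_le_of_norm_le_const (μ := P) (C := (k : ℝ))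
        (f := fun x => birkhoff (shift A) (t.indicator 1) n (r b (u x)) -
          birkhoff (shift A) (t.indicator 1) n x) ((hru b).mono fun x hx =>
          abs_birkhoff_indicator_sub_le_of_itin_eq hk E hx)
    have hbt := hb true
    have hbf := hb false
    set I := ∫ x, birkhoff (shift A) (t.indicator 1) n x ∂P
    set I1 := ∫ x, birkhoff (shift A) (t.indicator 1) n (r true (u x)) ∂P
    set I2 := ∫ x, birkhoff (shift A) (t.indicator 1) n (r false (u x)) ∂P
    have hcomb : |(θ * I1 + (1 - θ) * I2) - I| ≤ k := by
      rw [abs_le] at hbt hbf ⊢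
      constructor <;> nlinarith
    have hfin : |(N : ℝ)⁻¹ * ((θ * I1 + (1 - θ) * I2) - I)| ≤ (N : ℝ)⁻¹ * k := by
      rw [abs_mul, abs_of_nonneg hNpos]
      exact mul_le_mul_of_nonneg_left hcomb hNpos
    rw [abs_le] at hfin htν ⊢
    constructor <;> linarith

end Blocks

/-! ### Approximation at a fixed block length -/

lemma exists_convex_weight {p : Prop} {lo hi x y : ℝ} (hy : y ≤ hi) (hx : p → lo ≤ x)
    (hlh : p → lo ≤ hi) : ∃ θ : ℝ, 0 ≤ θ ∧ θ ≤ 1 ∧ θ * x + (1 - θ) * y ≤ hi ∧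
      (p → lo ≤ θ * x + (1 - θ) * y) := by
  by_cases hp : p
  · rcases le_or_gt lo y with h | h
    · exact ⟨0, le_rfl, zero_le_one, by linarith, fun _ => by linarith⟩
    · have hx := hx hp
      have hxy : 0 < x - y := by linarith
      have he : (lo - y) / (x - y) * x + (1 - (lo - y) / (x - y)) * y = lo := by
        field_simp; ring
      exact ⟨(lo - y) / (x - y), div_nonneg (by linarith) hxy.le,
        (div_le_one hxy).2 (by linarith), he.trans_le (hlh hp), fun _ => he.ge⟩
  · exact ⟨0, le_rfl, zero_le_one, by linarith, fun h => absurd h hp⟩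

section InvMul

variable {n N R : ℕ}

lemma one_sub_inv_mul_le (hn : 1 ≤ n) (hnN : n ≤ N) (hN : N ≤ n + R) :
    0 ≤ 1 - (N : ℝ)⁻¹ * n ∧ 1 - (N : ℝ)⁻¹ * n ≤ (n : ℝ)⁻¹ * R := by
  have h1 : (0 : ℝ) < n := by exact_mod_cast hn
  have h2 : (n : ℝ) ≤ N := by exact_mod_cast hnN
  have h3 : (N : ℝ) ≤ n + R := by exact_mod_cast hN
  have h4 : (N : ℝ)⁻¹ ≤ (n : ℝ)⁻¹ := inv_anti₀ h1 h2
  have h5 : (N : ℝ)⁻¹ * N = 1 := inv_mul_cancel₀ (by linarith)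
  have h6 : 1 - (N : ℝ)⁻¹ * n = (N : ℝ)⁻¹ * (N - n) := by rw [mul_sub, h5]
  rw [h6]
  exact ⟨mul_nonneg (by positivity) (by linarith),
    mul_le_mul h4 (by linarith) (by linarith) (by positivity)⟩

lemma inv_mul_le_of_le (hn : 1 ≤ n) (hnN : n ≤ N) (hN : N ≤ n + R) {x c : ℝ} (h : x ≤ n * c) :
    (N : ℝ)⁻¹ * x ≤ c + (n : ℝ)⁻¹ * (|c| * R) := by
  obtain ⟨h1, h2⟩ := one_sub_inv_mul_le hn hnN hN
  have h3 : (N : ℝ)⁻¹ * x ≤ (N : ℝ)⁻¹ * (n * c) := mul_le_mul_of_nonneg_left h (by positivity)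
  have h5 : (1 - (N : ℝ)⁻¹ * n) * (-c) ≤ (1 - (N : ℝ)⁻¹ * n) * |c| :=
    mul_le_mul_of_nonneg_left (neg_le_abs c) h1
  have h6 : (1 - (N : ℝ)⁻¹ * n) * |c| ≤ (n : ℝ)⁻¹ * R * |c| :=
    mul_le_mul_of_nonneg_right h2 (abs_nonneg c)
  linarith

lemma le_inv_mul_of_le (hn : 1 ≤ n) (hnN : n ≤ N) (hN : N ≤ n + R) {x c : ℝ} (h : n * c ≤ x) :
    c - (n : ℝ)⁻¹ * (|c| * R) ≤ (N : ℝ)⁻¹ * x := by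
  have := inv_mul_le_of_le hn hnN hN (x := -x) (c := -c) (by linarith)
  rw [abs_neg] at this
  linarith

end InvMul

lemma negMulLog_le_one {x : ℝ} (hx : 0 ≤ x) : Real.negMulLog x ≤ 1 := by
  rcases hx.eq_or_lt with rfl | h
  · simp
  · have h1 := Real.one_sub_inv_le_log_of_pos h
    have h2 := mul_le_mul_of_nonneg_left h1 hx
    rw [mul_sub, mul_inv_cancel₀ h.ne'] at h2
    rw [Real.negMulLog]
    linarith

section Block

open ProbabilityTheory

lemma birkhoff_le_birkhoff {X : Type*} (T : X → X) {f g : X → ℝ} (h : ∀ x, f x ≤ g x) (n : ℕ)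
    (x : X) : birkhoff T f n x ≤ birkhoff T g n x :=
  Finset.sum_le_sum fun _ _ => h _

lemma birkhoff_const {X : Type*} (T : X → X) (c : ℝ) (n : ℕ) (x : X) :
    birkhoff T (fun _ => c) n x = n * c := by
  simp [birkhoff]

lemma integrable_comp_of_fintype {X U : Type*} [MeasurableSpace X] [Finite U] [MeasurableSpace U]
    [MeasurableSingletonClass U] {P : Measure X} [IsFiniteMeasure P] {u : X → U}
    (hu : Measurable u) (f : U → ℝ) : Integrable (fun x => f (u x)) P :=
  (Integrable.of_finite (μ := P.map u) (f := f)).comp_measurable hu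

variable {S : Type*} {A : S → S → Prop} {e : S → ℕ} [TopologicalSpace S] [DiscreteTopology S]

lemma measurableSet_coord (i : ℕ) (F : Set S) : MeasurableSet {x : Space A | x.1 i ∈ F} :=
  ((isOpen_discrete F).preimage (continuous_coord i)).measurableSet

theorem exists_ergodic_of_block (he : e.Injective) {φ : Space A → ℝ} (hφ : Measurable φ) {C : ℝ}
    (hC : ∀ x, φ x ≤ C) {D : ℝ} (hD : BddDistortion φ D) (μ : Measure (Space A))
    [IsProbabilityMeasure μ] (hinv : Invariant (shift A) μ) {m n N R : ℕ} {K : ℝ} {a : S}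
    {F : Finset S} (hn : 1 ≤ n) (hN : N ≤ n + R)
    (hloop : ∀ x : Space A, x.1 0 ∈ F → x.1 (n - 1) ∈ F →
      ∃ (w : Space A) (s : ℕ), s ≤ R ∧ s + n ≤ N ∧ w.1 0 = a ∧ w.1 N = a ∧
        (∀ i < n, w.1 (s + i) = x.1 i) ∧
        ∀ y : Space A, (∀ i < N, y.1 i = w.1 i) →
          |birkhoff (shift A) φ N y - birkhoff (shift A) φ n x| ≤ K)
    {β : ℝ} (hβ : μ.real {x : Space A | x.1 0 ∈ F ∧ x.1 (n - 1) ∈ F}ᶜ ≤ β) (hβ' : β ≤ 1 / 2)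
    {L lo hi : ℝ}
    (hhi : ∫ x, max (φ x) (-L) ∂μ + 2 * (|C| + |L|) * β + (n : ℝ)⁻¹ ≤ hi)
    (hlo : Integrable φ μ → lo ≤ ∫ x, φ x ∂μ - 2 * β * (C - ∫ x, φ x ∂μ) - (n : ℝ)⁻¹) :
    ∃ ν : ProbabilityMeasure (Space A), Ergodic (shift A) (ν : Measure (Space A)) ∧
      entropy (shift A) (ν : Measure (Space A)) ≤ ENNReal.ofReal ((n : ℝ)⁻¹ *
        ((1 + 2 * β) * finEntropy μ (itin (shift A) (trunc e m) n) + 1)) ∧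
      ENNReal.ofReal ((n : ℝ)⁻¹ * (finEntropy μ (itin (shift A) (trunc e m) n) - 2 -
        Real.log (R + 1) - R * Real.log (m + 1)) - β * Real.log (m + 1)) ≤
          entropy (shift A) (ν : Measure (Space A)) ∧
      Integrable φ (ν : Measure (Space A)) ∧
      ∫ x, φ x ∂(ν : Measure (Space A)) ≤ hi + (n : ℝ)⁻¹ * (|hi| * R + K) ∧
      (Integrable φ μ →
        lo - (n : ℝ)⁻¹ * (|lo| * R + K) ≤ ∫ x, φ x ∂(ν : Measure (Space A))) ∧
      ∀ k ≤ m, ∀ E : Set (Fin k → Fin (k + 1)),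
        |(ν : Measure (Space A)).real (name e k ⁻¹' E) - μ.real (name e k ⁻¹' E)| ≤
          (n : ℝ)⁻¹ * (3 * R + 3 * k) + 2 * β := by
  set G : Set (Space A) := {x | x.1 0 ∈ F ∧ x.1 (n - 1) ∈ F} with hG
  have hGm : MeasurableSet G :=
    (measurableSet_coord 0 (F : Set S)).inter (measurableSet_coord (n - 1) (F : Set S))
  have hGc : μ.real Gᶜ = 1 - μ.real G := probReal_compl_eq_one_sub hGm
  have hGhalf : 1 / 2 ≤ μ.real G := by linarith
  have hG1 : μ.real G ≤ 1 := measureReal_le_one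
  have hβ0 : 0 ≤ β := measureReal_nonneg.trans hβ
  have hG0 : μ G ≠ 0 := fun h => by
    rw [measureReal_def, h] at hGhalf
    norm_num at hGhalf
  have hGne : G.Nonempty := nonempty_of_measure_ne_zero hG0
  have hP : IsProbabilityMeasure (cond μ G) := cond_isProbabilityMeasure hG0
  set P := cond μ G with hPdef
  have hPG : ∀ᵐ x ∂P, x ∈ G := ae_cond_mem hGm
  have hn0 : (0 : ℝ) < n := by exact_mod_cast hn
  set Φ := birkhoff (shift A) φ n with hΦ
  set u := itin (shift A) (trunc (A := A) e m) n with hu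
  have huf : FibMeas u := (fibMeas_trunc e m).itin measurable_shift n
  have hum : Measurable u := measurable_to_countable' huf
  have hΦC : ∀ x, Φ x ≤ n * C := fun x =>
    (birkhoff_le_birkhoff (shift A) hC n x).trans_eq (birkhoff_const _ _ _ _)
  -- the truncated potential
  have hφLm : Measurable fun x => max (φ x) (-L) := hφ.max measurable_const
  have hφLb : ∀ x, |max (φ x) (-L)| ≤ |C| + |L| := fun x => by
    have h1 := hC x
    have h2 := le_abs_self C
    have h3 := le_abs_self L
    have h4 := abs_nonneg C
    have h5 := abs_nonneg L
    have h6 := neg_abs_le L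
    rw [abs_le]
    exact ⟨(by linarith : -(|C| + |L|) ≤ -L).trans (le_max_right _ _),
      max_le (by linarith) (by linarith)⟩
  have hφLi : Integrable (fun x => max (φ x) (-L)) μ :=
    Integrable.of_bound hφLm.aestronglyMeasurable (|C| + |L|) (Eventually.of_forall hφLb)
  set ΦL := birkhoff (shift A) (fun x => max (φ x) (-L)) n with hΦL
  have hΦLi : Integrable ΦL μ := integrable_birkhoff measurable_shift hinv hφLi n
  have hΦLge : ∀ x, max (Φ x) (-(n * L)) ≤ ΦL x := fun x =>
    max_le (birkhoff_le_birkhoff _ (fun _ => le_max_left _ _) _ _) (by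
      rw [← mul_neg, ← birkhoff_const (shift A) (-L) n x]
      exact birkhoff_le_birkhoff _ (fun _ => le_max_right _ _) _ _)
  obtain ⟨r₁, hr₁, hr₁'⟩ := exists_representatives u hGne (f := Φ) (B := n * C) fun x _ => hΦC x
  obtain ⟨r₀, hr₀, hr₀'⟩ := exists_representatives u hGne
    (f := fun x => -max (Φ x) (-(n * L))) (B := n * L) fun x _ => by
      have := le_max_right (Φ x) (-(n * L)); linarith
  have hup : ∫ x, Φ (r₀ (u x)) ∂P ≤ n * hi := by
    have h1 : ∫ x, Φ (r₀ (u x)) ∂P ≤ ∫ x, (ΦL x + 1) ∂P := by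
      refine integral_mono_ae (integrable_comp_of_fintype hum fun v => Φ (r₀ v))
        ((integrable_cond hG0 hΦLi).add (integrable_const _)) (hPG.mono fun x hx => ?_)
      have h2 := (hr₀' x hx).2
      have h3 := hΦLge x
      have h4 := le_max_left (Φ (r₀ (u x))) (-(n * L))
      change Φ (r₀ (u x)) ≤ ΦL x + 1
      linarith
    rw [integral_add (integrable_cond hG0 hΦLi) (integrable_const _)] at h1
    have h2 := abs_integral_cond_sub_le hGm hG0 hΦLi (B := n * (|C| + |L|))
      fun x => abs_birkhoff_le fun i _ => hφLb _
    rw [integral_birkhoff measurable_shift hinv hφLi] at h2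
    have h3 := (abs_le.1 h2).2
    have h4 : 2 * (n * (|C| + |L|)) * μ.real Gᶜ ≤ 2 * (n * (|C| + |L|)) * β :=
      mul_le_mul_of_nonneg_left hβ (by positivity)
    have h5 := mul_le_mul_of_nonneg_left hhi hn0.le
    rw [mul_add, mul_inv_cancel₀ hn0.ne'] at h5
    simp only [integral_const, probReal_univ, one_smul] at h1
    linarith
  have hlow : Integrable φ μ → n * lo ≤ ∫ x, Φ (r₁ (u x)) ∂P := fun hi => by
    have hΦi : Integrable Φ μ := integrable_birkhoff measurable_shift hinv hi n
    have h1 : ∫ x, (Φ x - 1) ∂P ≤ ∫ x, Φ (r₁ (u x)) ∂P := by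
      refine integral_mono_ae ((integrable_cond hG0 hΦi).sub (integrable_const _))
        (integrable_comp_of_fintype hum fun v => Φ (r₁ v)) (hPG.mono fun x hx => ?_)
      have h2 := (hr₁' x hx).2
      change Φ x - 1 ≤ Φ (r₁ (u x))
      linarith
    rw [integral_sub (integrable_cond hG0 hΦi) (integrable_const _)] at h1
    simp only [integral_const, probReal_univ, one_smul] at h1
    have h2 := le_measureReal_mul_integral_cond hGm hG0 hΦi hΦC
    rw [integral_birkhoff measurable_shift hinv hi] at h2
    set I := ∫ x, φ x ∂μ
    have h3 : I ≤ C := by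
      have := integral_mono hi (integrable_const C) hC
      simpa using this
    have h4 := mul_le_mul_of_nonneg_left (hlo hi) hn0.le
    rw [mul_sub, mul_inv_cancel₀ hn0.ne'] at h4
    set J := ∫ x, Φ x ∂P
    have h5 : -(n * (C - I) * (2 * μ.real Gᶜ)) ≤ J - n * I := by
      by_contra! h
      have h6 : μ.real G * (J - n * I) < -(n * (C - I) * μ.real Gᶜ) := by
        have h7 : 0 ≤ n * (C - I) * μ.real Gᶜ :=
          mul_nonneg (mul_nonneg hn0.le (by linarith)) measureReal_nonneg
        nlinarith
      rw [hGc] at h2 h6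
      nlinarith
    have h8 : n * (C - I) * (2 * μ.real Gᶜ) ≤ n * (C - I) * (2 * β) :=
      mul_le_mul_of_nonneg_left (by linarith) (mul_nonneg hn0.le (by linarith))
    nlinarith
  have hlh : Integrable φ μ → n * lo ≤ n * hi := fun hi' => by
    refine mul_le_mul_of_nonneg_left ?_ hn0.le
    have h1 : ∫ x, φ x ∂μ ≤ ∫ x, max (φ x) (-L) ∂μ :=
      integral_mono hi' hφLi fun x => le_max_left _ _
    have h3 : ∫ x, φ x ∂μ ≤ C := by
      have := integral_mono hi' (integrable_const C) hC
      simpa using this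
    have h4 : 0 ≤ 2 * β * (C - ∫ x, φ x ∂μ) := mul_nonneg (by linarith) (by linarith)
    have h5 : 0 ≤ 2 * (|C| + |L|) * β := by positivity
    have h6 : 0 ≤ (n : ℝ)⁻¹ := by positivity
    have := hlo hi'
    linarith
  obtain ⟨θ, hθ0, hθ1, hθhi, hθlo⟩ := exists_convex_weight hup hlow hlh
  obtain ⟨hnN, ν, herg, hle, hge, hint, hφν, htν⟩ := exists_ergodic_of_representatives he hφ hD P
    hn hN hloop (fun b => bif b then r₁ else r₀)
    (fun b v => by cases b; exacts [hr₀ v, hr₁ v])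
    (fun b => hPG.mono fun x hx => by cases b; exacts [(hr₀' x hx).1, (hr₁' x hx).1]) hθ0 hθ1
  have hNn : (N : ℝ)⁻¹ ≤ (n : ℝ)⁻¹ := inv_anti₀ hn0 (by exact_mod_cast hnN)
  have hN0 : (0 : ℝ) ≤ (N : ℝ)⁻¹ := by positivity
  have hn0' : (0 : ℝ) ≤ (n : ℝ)⁻¹ := by positivity
  have hcard : Real.log (Fintype.card (Fin n → Fin (m + 1))) = n * Real.log (m + 1) := by
    simp
  have hlg : 0 ≤ Real.log ((m : ℝ) + 1) := Real.log_nonneg (by simp)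
  have hH0 := finEntropy_nonneg P u
  have hHP := finEntropy_le_log_card P huf
  rw [hcard] at hHP
  refine ⟨ν, herg, hle.trans (ENNReal.ofReal_le_ofReal ?_),
    (ENNReal.ofReal_le_ofReal ?_).trans hge, hint, ?_, fun hi' => ?_, fun k hk E => ?_⟩
  · have h1 := mul_finEntropy_cond_le μ hGm u
    have h2 : finEntropy P u ≤ (1 + 2 * β) * finEntropy μ u := by
      have h3 : 1 ≤ (1 + 2 * β) * μ.real G := by nlinarith
      calc finEntropy P u ≤ ((1 + 2 * β) * μ.real G) * finEntropy P u :=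
            le_mul_of_one_le_left hH0 h3
        _ ≤ _ := by rw [mul_assoc]; exact mul_le_mul_of_nonneg_left h1 (by linarith)
    have h4 : Real.log 2 ≤ 1 := by
      have := Real.log_two_lt_d9; linarith
    have h5 : 0 ≤ Real.log 2 := Real.log_nonneg (by norm_num)
    exact mul_le_mul hNn (by linarith) (by linarith) hn0'
  · have h1 := finEntropy_le_cond μ hGm hG0 huf
    rw [hcard] at h1
    have h2 := negMulLog_le_one (x := μ.real G) measureReal_nonneg
    have h3 := negMulLog_le_one (x := μ.real Gᶜ) measureReal_nonneg
    have h4 : μ.real G * finEntropy P u ≤ finEntropy P u := mul_le_of_le_one_left hH0 hG1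
    have h5 : μ.real Gᶜ * (n * Real.log (m + 1)) ≤ β * (n * Real.log (m + 1)) :=
      mul_le_mul_of_nonneg_right hβ (by positivity)
    have h6 : 0 ≤ Real.log ((R : ℝ) + 1) := Real.log_nonneg (by simp)
    set X := finEntropy P u - Real.log (R + 1) with hX
    have h7 : finEntropy μ u - 2 - Real.log (R + 1) - β * (n * Real.log (m + 1)) ≤ X := by
      linarith
    have h8 : ((n : ℝ)⁻¹ - (N : ℝ)⁻¹) * X ≤ ((n : ℝ)⁻¹ - (N : ℝ)⁻¹) * (n * Real.log (m + 1)) :=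
      mul_le_mul_of_nonneg_left (by linarith) (by linarith)
    have h9 : ((n : ℝ)⁻¹ - (N : ℝ)⁻¹) * (n * Real.log (m + 1)) =
        (1 - (N : ℝ)⁻¹ * n) * Real.log (m + 1) := by
      rw [← mul_assoc, sub_mul, inv_mul_cancel₀ hn0.ne']
    have h10 := mul_le_mul_of_nonneg_right (one_sub_inv_mul_le hn hnN hN).2 hlg
    have h11 := mul_le_mul_of_nonneg_left h7 hn0'
    have h12 : (n : ℝ)⁻¹ * (β * (n * Real.log (m + 1))) = β * Real.log (m + 1) := by
      field_simp
    rw [mul_sub _ _ (β * (n * Real.log (m + 1))), h12] at h11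
    rw [mul_sub _ _ (R * Real.log (m + 1)), ← mul_assoc _ (R : ℝ)]
    linarith
  · have h1 := inv_mul_le_of_le hn hnN hN hθhi
    have hK : 0 ≤ K := by
      obtain ⟨x, hx⟩ := hGne
      obtain ⟨w, s, -, -, -, -, -, h⟩ := hloop x hx.1 hx.2
      exact (abs_nonneg _).trans (h w fun _ _ => rfl)
    have h2 := mul_le_mul_of_nonneg_right hNn hK
    have h3 := (abs_le.1 hφν).2
    simp only [cond_true, cond_false] at h3
    rw [mul_add]
    linarith
  · have h1 := le_inv_mul_of_le hn hnN hN (hθlo hi')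
    have hK : 0 ≤ K := by
      obtain ⟨x, hx⟩ := hGne
      obtain ⟨w, s, -, -, -, -, -, h⟩ := hloop x hx.1 hx.2
      exact (abs_nonneg _).trans (h w fun _ _ => rfl)
    have h2 := mul_le_mul_of_nonneg_right hNn hK
    have h3 := (abs_le.1 hφν).1
    simp only [cond_true, cond_false] at h3
    rw [mul_add]
    linarith
  · have ht := htν k hk E
    set t : Set (Space A) := name e k ⁻¹' E with ht'
    have htm : MeasurableSet t := (fibMeas_name e k).preimage E
    have hti : Integrable (t.indicator (1 : Space A → ℝ)) μ :=
      (integrable_const (1 : ℝ)).indicator htm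
    have h1 := abs_integral_cond_sub_le hGm hG0
      (integrable_birkhoff measurable_shift hinv hti n) (B := n * 1)
      fun x => abs_birkhoff_le fun i _ => by
        by_cases h : (shift A)^[i] x ∈ t <;> simp [h]
    rw [integral_birkhoff measurable_shift hinv hti, integral_indicator_one htm, mul_one] at h1
    have h2 : 2 * n * μ.real Gᶜ ≤ 2 * n * β := mul_le_mul_of_nonneg_left hβ (by positivity)
    have h3 : (0 : ℝ) ≤ μ.real t := measureReal_nonneg
    have h4 : μ.real t ≤ 1 := measureReal_le_one
    rw [abs_le] at h1
    have h5 := inv_mul_le_of_le hn hnN hN (c := μ.real t + 2 * β)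
      (x := ∫ x, birkhoff (shift A) (t.indicator 1) n x ∂P) (by linarith [h1.2])
    have h6 := le_inv_mul_of_le hn hnN hN (c := μ.real t - 2 * β)
      (x := ∫ x, birkhoff (shift A) (t.indicator 1) n x ∂P) (by linarith [h1.1])
    have h7 : |μ.real t + 2 * β| ≤ 2 := by rw [abs_le]; constructor <;> linarith
    have h8 : |μ.real t - 2 * β| ≤ 2 := by rw [abs_le]; constructor <;> linarith
    have h9 := mul_le_mul_of_nonneg_left (mul_le_mul_of_nonneg_right h7 (Nat.cast_nonneg R)) hn0'
    have h10 := mul_le_mul_of_nonneg_left (mul_le_mul_of_nonneg_right h8 (Nat.cast_nonneg R)) hn0'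
    have h11 : (N : ℝ)⁻¹ * (R + 3 * k) ≤ (n : ℝ)⁻¹ * (R + 3 * k) :=
      mul_le_mul_of_nonneg_right hNn (by positivity)
    rw [abs_le] at ht ⊢
    constructor <;> linarith [ht.1, ht.2]

end Block

/-! ### Approximation of an invariant measure by ergodic measures -/

section Approx

variable {S : Type*} {A : S → S → Prop} {e : S → ℕ} [TopologicalSpace S] [DiscreteTopology S]

lemma exists_finset_coord (he : e.Injective) (μ : Measure (Space A)) [IsProbabilityMeasure μ]
    {δ : ℝ} (hδ : 0 < δ) : ∃ F : Finset S, μ.real {x : Space A | x.1 0 ∉ F} ≤ δ := by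
  have hfin : ∀ j : ℕ, {s | e s < j}.Finite := fun j =>
    (Set.finite_Iio j).preimage he.injOn
  have ht : Tendsto (fun j : ℕ => μ {x : Space A | x.1 0 ∉ (hfin j).toFinset}) atTop
      (𝓝 (μ (⋂ j, {x : Space A | x.1 0 ∉ (hfin j).toFinset}))) := by
    refine tendsto_measure_iInter_atTop (fun j => ?_) (fun i j hij x hx => ?_)
      ⟨0, measure_ne_top _ _⟩
    · exact (measurableSet_coord 0 ((hfin j).toFinset : Set S)ᶜ).nullMeasurableSet
    · simp only [Set.mem_ofPred_eq, Set.Finite.mem_toFinset, not_lt] at hx ⊢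
      omega
  have h0 : ⋂ j, {x : Space A | x.1 0 ∉ (hfin j).toFinset} = ∅ := by
    refine Set.eq_empty_of_forall_notMem fun x hx => ?_
    have := Set.mem_iInter.1 hx (e (x.1 0) + 1)
    simp at this
  rw [h0, measure_empty] at ht
  have hlt : (0 : ℝ≥0∞) < ENNReal.ofReal δ := by simpa using hδ
  obtain ⟨j, hj⟩ := (ht.eventually_lt_const hlt).exists
  exact ⟨(hfin j).toFinset, ENNReal.toReal_le_of_le_ofReal hδ.le hj.le⟩

lemma measureReal_compl_block_le {μ : Measure (Space A)} [IsProbabilityMeasure μ]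
    (hinv : Invariant (shift A) μ) {F : Finset S} {δ : ℝ}
    (hF : μ.real {x : Space A | x.1 0 ∉ F} ≤ δ) (n : ℕ) :
    μ.real {x : Space A | x.1 0 ∈ F ∧ x.1 (n - 1) ∈ F}ᶜ ≤ 2 * δ := by
  have hm : MeasurableSet {x : Space A | x.1 0 ∉ F} := measurableSet_coord 0 (F : Set S)ᶜ
  have hmp := (⟨measurable_shift, hinv⟩ : MeasurePreserving (shift A) μ μ).iterate (n - 1)
  have h1 : {x : Space A | x.1 0 ∈ F ∧ x.1 (n - 1) ∈ F}ᶜ ⊆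
      {x : Space A | x.1 0 ∉ F} ∪ (shift A)^[n - 1] ⁻¹' {x : Space A | x.1 0 ∉ F} := fun x hx => by
    simp only [Set.mem_compl_iff, Set.mem_ofPred_eq, Set.mem_union, Set.mem_preimage,
      shift_iterate_apply, zero_add] at hx ⊢
    tauto
  have h2 := (measureReal_mono (μ := μ) h1).trans (measureReal_union_le _ _)
  rw [hmp.measureReal_preimage hm.nullMeasurableSet] at h2
  linarith

lemma exists_frequently_entropyRate {X α : Type*} [MeasurableSpace X] [Fintype α] {T : X → X}
    {μ : Measure X} [IsProbabilityMeasure μ] {p : X → α} {h : ℝ}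
    (hp : entropyRate T μ p ≤ ENNReal.ofReal h) (hh : 0 ≤ h) {η ε : ℝ} (hη : 0 < η)
    (hε : 0 ≤ ε) (hge : ENNReal.ofReal h ≤ entropyRate T μ p + ENNReal.ofReal ε) :
    ∃ᶠ n : ℕ in atTop, (n : ℝ)⁻¹ * finEntropy μ (itin T p n) ≤ h + η ∧
      h ≤ (n : ℝ)⁻¹ * finEntropy μ (itin T p n) + (ε + η) := by
  have hη' : ENNReal.ofReal η ≠ 0 := by simpa using hη
  have htop : entropyRate T μ p ≠ ⊤ := ne_top_of_le_ne_top ENNReal.ofReal_ne_top hp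
  have h1 : ∃ᶠ n : ℕ in atTop, ENNReal.ofReal ((n : ℝ)⁻¹ * finEntropy μ (itin T p n)) <
      entropyRate T μ p + ENNReal.ofReal η :=
    frequently_lt_of_liminf_lt (h := ENNReal.lt_add_right htop hη')
  have h2 : ∀ᶠ n : ℕ in atTop, entropyRate T μ p ≤
      ENNReal.ofReal ((n : ℝ)⁻¹ * finEntropy μ (itin T p n)) + ENNReal.ofReal η := by
    by_cases h0 : entropyRate T μ p = 0
    · simp [h0]
    · have : entropyRate T μ p - ENNReal.ofReal η < entropyRate T μ p :=
        ENNReal.sub_lt_self htop h0 hη'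
      exact (eventually_lt_of_lt_liminf this).mono fun n hn => tsub_le_iff_right.1 hn.le
  refine (h1.and_eventually h2).mono fun n hn => ?_
  have hH : 0 ≤ (n : ℝ)⁻¹ * finEntropy μ (itin T p n) :=
    mul_nonneg (by positivity) (finEntropy_nonneg μ _)
  constructor
  · have h3 := hn.1.le.trans (add_le_add_left hp _)
    rw [← ENNReal.ofReal_add hh hη.le] at h3
    exact (ENNReal.ofReal_le_ofReal_iff (by linarith)).1 h3
  · have h3 := hge.trans (add_le_add_left hn.2 _)
    rw [← ENNReal.ofReal_add hH hη.le, ← ENNReal.ofReal_add (by linarith) hε] at h3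
    have := (ENNReal.ofReal_le_ofReal_iff (by linarith)).1 h3
    linarith

theorem exists_ergodic_approx (he : e.Injective) (htrans : TopTransitive A) {φ : Space A → ℝ}
    (hφ : Measurable φ) {C : ℝ} (hC : ∀ x, φ x ≤ C) {D : ℝ} (hD : BddDistortion φ D)
    (μ : Measure (Space A)) [IsProbabilityMeasure μ] (hinv : Invariant (shift A) μ)
    (hent : entropy (shift A) μ ≠ ⊤) (k₀ : ℕ) {ε : ℝ} (hε : 0 < ε) {L c : ℝ}
    (hc : ∫ x, max (φ x) (-L) ∂μ ≤ c) :
    ∃ ν : ProbabilityMeasure (Space A), Ergodic (shift A) (ν : Measure (Space A)) ∧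
      entropy (shift A) (ν : Measure (Space A)) ≤ entropy (shift A) μ + ENNReal.ofReal ε ∧
      entropy (shift A) μ ≤ entropy (shift A) (ν : Measure (Space A)) + ENNReal.ofReal ε ∧
      Integrable φ (ν : Measure (Space A)) ∧
      ∫ x, φ x ∂(ν : Measure (Space A)) ≤ c + ε ∧
      (Integrable φ μ → ∫ x, φ x ∂μ - ε ≤ ∫ x, φ x ∂(ν : Measure (Space A))) ∧
      ∀ k ≤ k₀, ∀ E : Set (Fin k → Fin (k + 1)),
        |(ν : Measure (Space A)).real (name e k ⁻¹' E) - μ.real (name e k ⁻¹' E)| ≤ ε := by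
  obtain ⟨m, hm, hrate⟩ := exists_entropyRate_trunc_ge he μ hinv hent k₀ (ε := ε / 4) (by linarith)
  obtain ⟨x₀⟩ := μ.nonempty_of_neZero
  obtain ⟨h, hh⟩ : ∃ h, h = (entropy (shift A) μ).toReal := ⟨_, rfl⟩
  have hh0 : 0 ≤ h := hh ▸ ENNReal.toReal_nonneg
  have hhμ : entropy (shift A) μ = ENNReal.ofReal h := by rw [hh, ENNReal.ofReal_toReal hent]
  have hlg : 0 ≤ Real.log ((m : ℝ) + 1) := Real.log_nonneg (by simp)
  set lg := Real.log ((m : ℝ) + 1) with hlgdef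
  set I := ∫ x, φ x ∂μ
  set T := 1 + h + ε + lg + |C| + |L| + |C - I| with hT
  have hTpos : 0 < T := by positivity
  obtain ⟨β, hβ0, hβhalf, hβT⟩ : ∃ β : ℝ, 0 < β ∧ β ≤ 1 / 2 ∧ 2 * β * T ≤ ε / 4 := by
    refine ⟨min (1 / 2) (ε / (8 * T)), lt_min (by norm_num) (by positivity), min_le_left _ _, ?_⟩
    have := mul_le_mul_of_nonneg_right (min_le_right (1 / 2) (ε / (8 * T))) hTpos.le
    have h2 : ε / (8 * T) * T = ε / 8 := by field_simp
    linarith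
  have hβ' : ∀ T', T' ≤ T → 2 * β * T' ≤ ε / 4 := fun T' hT' =>
    (mul_le_mul_of_nonneg_left hT' (by linarith)).trans hβT
  have hC0 := abs_nonneg C
  have hL0 := abs_nonneg L
  have hCI0 := abs_nonneg (C - I)
  obtain ⟨F, hF⟩ := exists_finset_coord he μ (δ := β / 2) (by linarith)
  obtain ⟨R, K, hRK⟩ := exists_loop htrans hD (x₀.1 0) F
  have hlR : 0 ≤ Real.log ((R : ℝ) + 1) := Real.log_nonneg (by simp)
  set hi := c + ε / 2 with hhi
  set lo := I - ε / 2 with hlo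
  set T₂ := 3 + Real.log (R + 1) + R * lg + (|hi| + |lo|) * R + |K| + 3 * R + 3 * k₀ with hT₂
  have hlim : Tendsto (fun n : ℕ => (n : ℝ)⁻¹ * T₂) atTop (𝓝 0) := by
    simpa using (tendsto_inv_atTop_nhds_zero_nat (𝕜 := ℝ)).mul_const T₂
  have hev := (hlim.eventually_le_const (show (0 : ℝ) < ε / 4 by linarith)).and
    (eventually_ge_atTop 1)
  have hrate_le := entropyRate_le_entropy (shift A) μ (fibMeas_trunc (A := A) e m)
  rw [hhμ] at hrate_le hrate
  obtain ⟨n, ⟨hH1, hH2⟩, hnT, hn⟩ := ((exists_frequently_entropyRate hrate_le hh0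
    (η := ε / 4) (by linarith) (by linarith) hrate).and_eventually hev).exists
  have hn0 : (0 : ℝ) ≤ (n : ℝ)⁻¹ := by positivity
  have hnT' : ∀ T', T' ≤ T₂ → (n : ℝ)⁻¹ * T' ≤ ε / 4 := fun T' hT' =>
    (mul_le_mul_of_nonneg_left hT' hn0).trans hnT
  have hR0 : (0 : ℝ) ≤ R := Nat.cast_nonneg R
  have hk0 : (0 : ℝ) ≤ k₀ := Nat.cast_nonneg k₀
  have hRlg : 0 ≤ R * lg := mul_nonneg hR0 hlg
  have hhiR : 0 ≤ |hi| * R := by positivity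
  have hloR : 0 ≤ |lo| * R := by positivity
  have hK0 := abs_nonneg K
  have hK1 := le_abs_self K
  have hn1 : (n : ℝ)⁻¹ ≤ ε / 4 := by
    have := hnT' 1 (by rw [hT₂]; linarith)
    linarith
  obtain ⟨N, hN, hloop⟩ := hRK n hn
  obtain ⟨ν, herg, hle, hge, hint, hup, hlow, ht⟩ := exists_ergodic_of_block (m := m) he hφ hC hD μ
    hinv hn hN hloop (β := β)
    (by simpa using (measureReal_compl_block_le hinv hF n).trans (by linarith)) hβhalf
    (L := L) (lo := lo) (hi := hi)
    (by
      have := hβ' (|C| + |L|) (by rw [hT]; linarith)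
      rw [hhi]; linarith)
    (fun _ => by
      have := hβ' (C - I) (by rw [hT]; linarith [le_abs_self (C - I)])
      rw [hlo]; linarith)
  set H := finEntropy μ (itin (shift A) (trunc (A := A) e m) n)
  refine ⟨ν, herg, hle.trans ?_, ?_, hint, hup.trans ?_, fun h' => le_trans ?_ (hlow h'),
    fun k hk E => (ht k (hk.trans hm) E).trans ?_⟩
  · rw [hhμ, ← ENNReal.ofReal_add hh0 hε.le]
    refine ENNReal.ofReal_le_ofReal ?_
    have h1 := hβ' (h + ε / 4) (by rw [hT]; linarith)
    have h2 : (1 + 2 * β) * ((n : ℝ)⁻¹ * H) ≤ (1 + 2 * β) * (h + ε / 4) :=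
      mul_le_mul_of_nonneg_left hH1 (by linarith)
    linarith
  · rw [hhμ]
    refine le_trans ?_ (add_le_add_left hge _)
    refine le_trans (ENNReal.ofReal_le_ofReal ?_) ENNReal.ofReal_add_le
    have h1 := hnT' (2 + Real.log (R + 1) + R * lg) (by rw [hT₂]; linarith)
    have h2 := hβ' lg (by rw [hT]; linarith)
    linarith
  · have := hnT' (|hi| * R + K) (by rw [hT₂]; linarith)
    linarith
  · have := hnT' (|lo| * R + K) (by rw [hT₂]; linarith)
    linarith
  · have hkk : (k : ℝ) ≤ k₀ := by exact_mod_cast hk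
    have h1 := hnT' (3 * R + 3 * k) (by rw [hT₂]; linarith)
    have h2 := hβ' 1 (by rw [hT]; linarith)
    linarith

end Approx

/-! ### Integrals of functions bounded above -/

section UpperBounded

variable {X : Type*} [MeasurableSpace X] {φ : X → ℝ} {C : ℝ} {μ : Measure X}

lemma eintegral_of_integrable (h : Integrable φ μ) :
    eintegral φ μ = ((∫ x, φ x ∂μ : ℝ) : EReal) := by
  have h1 : ∫⁻ x, ENNReal.ofReal (φ x) ∂μ ≠ ⊤ := h.lintegral_lt_top.ne
  have h2 : ∫⁻ x, ENNReal.ofReal (-φ x) ∂μ ≠ ⊤ := h.neg.lintegral_lt_top.ne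
  rw [eintegral, integral_eq_lintegral_pos_part_sub_lintegral_neg_part h, EReal.coe_sub,
    EReal.coe_ennreal_toReal h1, EReal.coe_ennreal_toReal h2]

lemma exists_integral_max_le_add (h : Integrable φ μ) {δ : ℝ} (hδ : 0 < δ) :
    ∃ L : ℝ, ∫ x, max (φ x) (-L) ∂μ ≤ ∫ x, φ x ∂μ + δ := by
  have ht : Tendsto (fun L : ℕ => ∫ x, max (φ x) (-(L : ℝ)) ∂μ) atTop (𝓝 (∫ x, φ x ∂μ)) := by
    refine tendsto_integral_of_dominated_convergence (fun x => |φ x|) (fun L => ?_) h.abs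
      (fun L => ae_of_all _ fun x => ?_) (ae_of_all _ fun x => ?_)
    · exact h.aestronglyMeasurable.sup aestronglyMeasurable_const
    · have hL : (0 : ℝ) ≤ L := Nat.cast_nonneg L
      rw [Real.norm_eq_abs, abs_le]
      exact ⟨(neg_abs_le _).trans (le_max_left _ _),
        max_le (le_abs_self _) ((neg_nonpos.2 hL).trans (abs_nonneg _))⟩
    · obtain ⟨N, hN⟩ := exists_nat_ge (-φ x)
      refine tendsto_const_nhds.congr' ?_
      filter_upwards [eventually_ge_atTop N] with L hL
      have : (N : ℝ) ≤ L := by exact_mod_cast hL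
      rw [max_eq_left (by linarith)]
  obtain ⟨L, hL⟩ := (ht.eventually (gt_mem_nhds (lt_add_of_pos_right _ hδ))).exists
  exact ⟨L, hL.le⟩

variable [IsProbabilityMeasure μ]

lemma lintegral_ofReal_ne_top_of_le (hC : ∀ x, φ x ≤ C) :
    ∫⁻ x, ENNReal.ofReal (φ x) ∂μ ≠ ⊤ := by
  refine ne_top_of_le_ne_top ?_ (lintegral_mono fun x => ENNReal.ofReal_le_ofReal (hC x))
  simp

lemma eintegral_of_not_integrable (hφ : Measurable φ) (hC : ∀ x, φ x ≤ C)
    (h : ¬ Integrable φ μ) : eintegral φ μ = ⊥ := by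
  have h1 := lintegral_ofReal_ne_top_of_le (μ := μ) hC
  have h2 : ∫⁻ x, ENNReal.ofReal (-φ x) ∂μ = ⊤ := by
    by_contra h2
    refine h ⟨hφ.aestronglyMeasurable, ?_⟩
    rw [hasFiniteIntegral_iff_norm]
    refine lt_of_le_of_lt (lintegral_mono (g := fun x => ENNReal.ofReal (φ x) +
      ENNReal.ofReal (-φ x)) fun x => ?_) ?_
    · rcases le_total 0 (φ x) with hx | hx
      · simp [abs_of_nonneg hx]
      · simp [abs_of_nonpos hx]
    · rw [lintegral_add_left (by fun_prop)]
      exact ENNReal.add_lt_top.2 ⟨h1.lt_top, lt_top_iff_ne_top.2 h2⟩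
  rw [eintegral, h2, sub_eq_add_neg]
  simp

lemma exists_integral_max_le (hφ : Measurable φ) (hC : ∀ x, φ x ≤ C) (h : ¬ Integrable φ μ)
    (c : ℝ) : ∃ L : ℝ, ∫ x, max (φ x) (-L) ∂μ ≤ c := by
  by_contra! hcon
  have hle : ∀ (L : ℕ) x, max (φ x) (-(L : ℝ)) ≤ |C| := fun L x =>
    max_le ((hC x).trans (le_abs_self _))
      ((neg_nonpos.2 (Nat.cast_nonneg L)).trans (abs_nonneg _))
  have hint : ∀ L : ℕ, Integrable (fun x => max (φ x) (-(L : ℝ))) μ := fun L =>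
    Integrable.of_mem_Icc (-(L : ℝ)) |C| (by fun_prop)
      (ae_of_all _ fun x => ⟨le_max_right _ _, hle L x⟩)
  have hbd : ∀ L : ℕ, ∫⁻ x, ENNReal.ofReal (|C| - max (φ x) (-(L : ℝ))) ∂μ ≤
      ENNReal.ofReal (|C| - c) := fun L => by
    have h1 : Integrable (fun x => |C| - max (φ x) (-(L : ℝ))) μ :=
      (integrable_const _).sub (hint L)
    rw [← ofReal_integral_eq_lintegral_ofReal h1 (ae_of_all _ fun x => sub_nonneg.2 (hle L x)),
      integral_sub (integrable_const _) (hint L)]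
    refine ENNReal.ofReal_le_ofReal ?_
    have := hcon L
    simp only [integral_const, probReal_univ, one_smul]
    linarith
  have hlim : ∀ x, atTop.liminf (fun L : ℕ => ENNReal.ofReal (|C| - max (φ x) (-(L : ℝ)))) =
      ENNReal.ofReal (|C| - φ x) := fun x => by
    obtain ⟨N, hN⟩ := exists_nat_ge (-φ x)
    refine (tendsto_const_nhds.congr' ?_).liminf_eq
    filter_upwards [eventually_ge_atTop N] with L hL
    have : (N : ℝ) ≤ L := by exact_mod_cast hL
    rw [max_eq_left (by linarith)]
  have hfin : ∫⁻ x, ENNReal.ofReal (|C| - φ x) ∂μ ≤ ENNReal.ofReal (|C| - c) := by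
    simp_rw [← hlim]
    refine (lintegral_liminf_le fun L => by fun_prop).trans ?_
    exact liminf_le_of_le (by isBoundedDefault) fun b hb => by
      obtain ⟨L, hL⟩ := hb.exists
      exact hL.trans (hbd L)
  have hI : Integrable (fun x => |C| - φ x) μ := by
    refine ⟨by fun_prop, ?_⟩
    rw [hasFiniteIntegral_iff_ofReal (ae_of_all _ fun x =>
      sub_nonneg.2 ((hC x).trans (le_abs_self _)))]
    exact hfin.trans_lt ENNReal.ofReal_lt_top
  refine h (((integrable_const |C|).sub hI).congr (ae_of_all _ fun x => ?_))
  simp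

end UpperBounded

/-! ### Convergence of the approximating measures -/

section Convergence

variable {S : Type*} {A : S → S → Prop} {e : S → ℕ}

lemma word_get (x : Space A) (n : ℕ) (i : Fin (word x n).length) :
    (word x n).get i = x.1 i := by
  unfold word at i ⊢
  simp

lemma bddDistortion_of_cylinder {φ : Space A → ℝ} {C : ℝ}
    (h : ∀ n : ℕ, 1 ≤ n → ∀ w : List S, Admissible A w → w.length = n →
      ∀ x ∈ cylinder A w, ∀ y ∈ cylinder A w,
        birkhoff (shift A) φ n x - birkhoff (shift A) φ n y ≤ C) : BddDistortion φ C := by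
  intro n hn x y hxy
  have hw : Admissible A (word x n) := by
    refine ⟨fun hnil => ?_, ?_⟩
    · have := congrArg List.length hnil
      simp only [word, List.length_ofFn, List.length_nil] at this
      omega
    · refine List.isChain_iff_getElem.2 ?_
      intro i hi
      simpa [word] using x.2 i
  have hx : x ∈ cylinder A (word x n) := fun i => (word_get x n i).symm
  have hy : y ∈ cylinder A (word x n) := fun i => by
    have hi : (i : ℕ) < n := by simpa [word] using i.2
    exact (hxy i hi).symm.trans (word_get x n i).symm
  have hlen : (word x n).length = n := by simp [word]
  rw [abs_sub_le_iff]
  exact ⟨h n hn _ hw hlen x hx y hy, h n hn _ hw hlen y hy x hx⟩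

lemma tendsto_of_name [TopologicalSpace S] (he : e.Injective) {μ : ProbabilityMeasure (Space A)}
    {ν : ℕ → ProbabilityMeasure (Space A)} {ε : ℕ → ℝ} (hε : Tendsto ε atTop (𝓝 0))
    (h : ∀ j, ∀ k ≤ j, ∀ E, |(ν j : Measure (Space A)).real (name e k ⁻¹' E) -
      (μ : Measure (Space A)).real (name e k ⁻¹' E)| ≤ ε j) : Tendsto ν atTop (𝓝 μ) := by
  refine tendsto_of_forall_isOpen_le_liminf' fun G hG => ?_
  have hcore : ∀ k, (μ : Measure (Space A)) (nameCore e k G) ≤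
      atTop.liminf fun j => (ν j : Measure (Space A)) G := fun k => by
    have h1 : Tendsto (fun j => (ν j : Measure (Space A)).real (nameCore e k G)) atTop
        (𝓝 ((μ : Measure (Space A)).real (nameCore e k G))) := by
      rw [tendsto_iff_dist_tendsto_zero]
      refine squeeze_zero' (Eventually.of_forall fun _ => dist_nonneg) ?_ hε
      filter_upwards [eventually_ge_atTop k] with j hj
      exact h j k hj _
    have h2 := (ENNReal.tendsto_ofReal h1).liminf_eq
    simp only [measureReal_def, ENNReal.ofReal_toReal (measure_ne_top _ _)] at h2
    rw [← h2]
    refine liminf_le_liminf (Eventually.of_forall fun j => measure_mono ?_)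
    exact (subset_iUnion (fun k => nameCore e k G) k).trans (iUnion_nameCore he hG).subset
  have h3 := (nameCore_mono e G).measure_iUnion (μ := (μ : Measure (Space A)))
  rw [iUnion_nameCore he hG] at h3
  rw [h3]
  exact iSup_le hcore

end Convergence

end CMS

open CMS in
/-- **Entropy-density of ergodic measures.** For a transitive countable Markov shift and a
measurable `φ` with `sup φ < ∞` and `sup_n D_n(φ) < ∞`, every `σ`-invariant measure `μ` of
finite entropy is a weak*-limit of ergodic measures `μ_k ∈ M_φ(σ)` with `h(μ_k) → h(μ)` and
`∫φ dμ_k → ∫φ dμ`. -/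
theorem entropy_density {S : Type*} [Countable S] [TopologicalSpace S] [DiscreteTopology S]
    (A : S → S → Prop) (hA : NoZeroRowCol A) (htrans : TopTransitive A)
    (φ : Space A → ℝ) (hφ : Measurable φ)
    (hbdd : ∃ C : ℝ, ∀ x, φ x ≤ C)
    (hD : ∃ C : ℝ, ∀ n : ℕ, 1 ≤ n → ∀ w : List S, Admissible A w → w.length = n →
      ∀ x ∈ cylinder A w, ∀ y ∈ cylinder A w,
        birkhoff (shift A) φ n x - birkhoff (shift A) φ n y ≤ C)
    (μ : ProbabilityMeasure (Space A)) (hinv : Invariant (shift A) (μ : Measure (Space A)))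
    (hent : entropy (shift A) (μ : Measure (Space A)) ≠ ⊤) :
    ∃ μk : ℕ → ProbabilityMeasure (Space A),
      (∀ k, Ergodic (shift A) ((μk k : Measure (Space A))) ∧
        IntegralGtBot φ ((μk k : Measure (Space A)))) ∧
      Tendsto μk atTop (nhds μ) ∧
      Tendsto (fun k => entropy (shift A) ((μk k : Measure (Space A)))) atTop
        (nhds (entropy (shift A) (μ : Measure (Space A)))) ∧
      Tendsto (fun k => eintegral φ ((μk k : Measure (Space A)))) atTop
        (nhds (eintegral φ (μ : Measure (Space A)))) := by
  obtain ⟨C, hC⟩ := hbdd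
  obtain ⟨D, hD⟩ := hD
  obtain ⟨e, he⟩ := exists_injective_nat S
  let ε : ℕ → ℝ := fun k => 1 / ((k : ℝ) + 1)
  have hε : ∀ k, 0 < ε k := fun k => Nat.one_div_pos_of_nat
  have hε0 : Tendsto ε atTop (𝓝 0) := tendsto_one_div_add_atTop_nhds_zero_nat
  have hc : ∃ c : ℕ → ℝ, (∀ k, ∃ L : ℝ, ∫ x, max (φ x) (-L) ∂(μ : Measure (Space A)) ≤ c k) ∧
      (Integrable φ (μ : Measure (Space A)) → Tendsto c atTop (𝓝 (∫ x, φ x ∂(μ : Measure _)))) ∧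
      (¬ Integrable φ (μ : Measure (Space A)) → Tendsto c atTop atBot) := by
    by_cases hI : Integrable φ (μ : Measure (Space A))
    · refine ⟨fun k => ∫ x, φ x ∂(μ : Measure _) + ε k,
        fun k => exists_integral_max_le_add hI (hε k), fun _ => ?_, fun h => absurd hI h⟩
      simpa using hε0.const_add (∫ x, φ x ∂(μ : Measure (Space A)))
    · exact ⟨fun k => -(k : ℝ), fun k => exists_integral_max_le hφ hC hI _, fun h => absurd h hI,
        fun _ => tendsto_neg_atTop_atBot.comp tendsto_natCast_atTop_atTop⟩
  obtain ⟨c, hcL, hc1, hc2⟩ := hc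
  choose L hL using hcL
  choose ν herg hent1 hent2 hint hup hlow hname using fun k =>
    exists_ergodic_approx he htrans hφ hC (bddDistortion_of_cylinder hD) (μ : Measure (Space A))
      hinv hent k (hε k) (hL k)
  refine ⟨ν, fun k => ⟨herg k, (hint k).neg.lintegral_lt_top.ne⟩, tendsto_of_name he hε0 hname,
    ?_, ?_⟩
  · have hε' : Tendsto (fun k => ENNReal.ofReal (ε k)) atTop (𝓝 0) := by
      simpa using ENNReal.tendsto_ofReal hε0
    refine tendsto_of_tendsto_of_tendsto_of_le_of_le
      (g := fun k => entropy (shift A) (μ : Measure (Space A)) - ENNReal.ofReal (ε k))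
      (h := fun k => entropy (shift A) (μ : Measure (Space A)) + ENNReal.ofReal (ε k)) ?_ ?_
      (fun k => tsub_le_iff_right.2 (hent2 k)) hent1
    · simpa using ENNReal.Tendsto.sub (tendsto_const_nhds (x := entropy (shift A)
        (μ : Measure (Space A)))) hε' (Or.inl hent)
    · simpa using hε'.const_add (entropy (shift A) (μ : Measure (Space A)))
  · simp_rw [fun k => eintegral_of_integrable (hint k)]
    by_cases hI : Integrable φ (μ : Measure (Space A))
    · rw [eintegral_of_integrable hI, EReal.tendsto_coe]
      refine tendsto_of_tendsto_of_tendsto_of_le_of_le ?_ ?_ (fun k => hlow k hI) hup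
      · simpa using hε0.const_sub (∫ x, φ x ∂(μ : Measure (Space A)))
      · simpa using (hc1 hI).add hε0
    · rw [eintegral_of_not_integrable hφ hC hI]
      refine EReal.tendsto_coe_nhds_bot_iff.2 (tendsto_atBot_mono hup ?_)
      exact (hc2 hI).atBot_add hε0
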